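/- (Conjecture.) Fix an integer k ≥ 1 and let n be a positive integer with n ≥ 2κ; set λ = n/κ (so the mean equals n). Then the Poisson distribution of order k with parameter λ has mode m_k(n/κ) = n − ⌊(3k+5)/8⌋; for k > 1 this mode is unique (f_k attains its global maximum at exactly this one point). -/

import Mathlib

open scoped BigOperators

/-- The pmf of the Poisson distribution of order `k` with parameter `lam`:
`f_k(n;λ) = e^{-kλ} Σ_{n₁+2n₂+⋯+k n_k = n} λ^{n₁+⋯+n_k}/(n₁!⋯n_k!)`. -/
noncomputable def poissonOrderKPmf (k : ℕ) (lam : ℝ) (n : ℕ) : ℝ :=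
  Real.exp (-(k * lam)) *
    ∑' v : Fin k → ℕ,
      if (∑ i : Fin k, ((i : ℕ) + 1) * v i) = n then
        lam ^ (∑ i : Fin k, v i) / ((∏ i : Fin k, Nat.factorial (v i) : ℕ) : ℝ)
      else 0

/-- The median of the Poisson distribution of order `k` with parameter `lam`:
the least integer `n` such that `P(X ≤ n) ≥ 1/2`. -/
noncomputable def poissonOrderKMedian (k : ℕ) (lam : ℝ) : ℕ :=
  sInf {n : ℕ | (1 : ℝ) / 2 ≤ ∑ j ∈ Finset.range (n + 1), poissonOrderKPmf k lam j}

/-- The weighted sum `Σ (i+1) v_i` of a tuple. -/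
def tupleWeight {k : ℕ} (v : Fin k → ℕ) : ℕ := ∑ i : Fin k, ((i : ℕ) + 1) * v i

/-- The summand `λ^{Σ v_i} / ∏ v_i!`. -/
noncomputable def tupleTerm {k : ℕ} (lam : ℝ) (v : Fin k → ℕ) : ℝ :=
  lam ^ (∑ i : Fin k, v i) / ((∏ i : Fin k, Nat.factorial (v i) : ℕ) : ℝ)

/-- The tuples of weight `m`. -/
def tuplesOfWeight (k m : ℕ) : Finset (Fin k → ℕ) :=
  (Fintype.piFinset fun _ => Finset.range (m + 1)).filter fun v => tupleWeight v = m

/-- The pmf without its exponential prefactor. -/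
noncomputable def orderKCoeff (k : ℕ) (lam : ℝ) (m : ℕ) : ℝ :=
  ∑ v ∈ tuplesOfWeight k m, tupleTerm lam v

theorem mem_tuplesOfWeight {k m : ℕ} {v : Fin k → ℕ} :
    v ∈ tuplesOfWeight k m ↔ tupleWeight v = m := by
  simp only [tuplesOfWeight, Finset.mem_filter, Fintype.mem_piFinset, Finset.mem_range,
    and_iff_right_iff_imp]
  intro h i
  have : ((i : ℕ) + 1) * v i ≤ tupleWeight v :=
    Finset.single_le_sum (f := fun i : Fin k => ((i : ℕ) + 1) * v i) (fun _ _ => Nat.zero_le _)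
      (Finset.mem_univ i)
  nlinarith

theorem orderKCoeff_zero (k : ℕ) (lam : ℝ) : orderKCoeff k lam 0 = 1 := by
  have : tuplesOfWeight k 0 = {0} := by
    ext v
    rw [mem_tuplesOfWeight, Finset.mem_singleton]
    constructor
    · intro h
      funext i
      have := (Finset.sum_eq_zero_iff.mp h) i (Finset.mem_univ i)
      simpa using this
    · rintro rfl; simp [tupleWeight]
  simp [orderKCoeff, this, tupleTerm]

theorem sum_mul_tupleTerm (k : ℕ) (lam : ℝ) (m : ℕ) (i : Fin k) :
    ∑ v ∈ tuplesOfWeight k m, (v i : ℝ) * tupleTerm lam v =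
      if (i : ℕ) + 1 ≤ m then lam * orderKCoeff k lam (m - ((i : ℕ) + 1)) else 0 := by
  have hw : ∀ w : Fin k → ℕ, tupleWeight (w + Pi.single i 1) = tupleWeight w + ((i : ℕ) + 1) := by
    intro w
    simp only [tupleWeight, Pi.add_apply, mul_add, Finset.sum_add_distrib]
    congr 1
    rw [Finset.sum_eq_single i] <;> simp +contextual
  have ht : ∀ w : Fin k → ℕ, ((w + Pi.single i 1 : Fin k → ℕ) i : ℝ) *
      tupleTerm lam (w + Pi.single i 1) = lam * tupleTerm lam w := by
    intro w
    have h1 : ∑ j, (w + Pi.single i 1 : Fin k → ℕ) j = ∑ j, w j + 1 := by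
      simp [Finset.sum_add_distrib]
    have h2 : ∏ j, Nat.factorial ((w + Pi.single i 1 : Fin k → ℕ) j) =
        (w i + 1) * ∏ j, Nat.factorial (w j) := by
      rw [← Finset.mul_prod_erase _ _ (Finset.mem_univ i),
        ← Finset.mul_prod_erase (f := fun j => Nat.factorial (w j)) _ (Finset.mem_univ i),
        ← mul_assoc]
      congr 1
      · simp [Nat.factorial_succ]
      · refine Finset.prod_congr rfl fun j hj => ?_
        simp [(Finset.mem_erase.mp hj).1]
    have h3 : ((∏ j, Nat.factorial (w j) : ℕ) : ℝ) ≠ 0 := by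
      exact_mod_cast Finset.prod_ne_zero_iff.mpr fun j _ => Nat.factorial_ne_zero _
    have h4 : ((w i : ℝ) + 1) ≠ 0 := by positivity
    unfold tupleTerm
    rw [h1, h2, pow_succ, Nat.cast_mul]
    simp only [Pi.add_apply, Pi.single_eq_same, Nat.cast_add, Nat.cast_one]
    field_simp
  split_ifs with him
  · rw [orderKCoeff, Finset.mul_sum]
    symm
    refine Finset.sum_bij_ne_zero (fun w _ _ => w + Pi.single i 1) ?_ ?_ ?_ ?_
    · intro w hw' _
      rw [mem_tuplesOfWeight] at hw' ⊢
      rw [hw, hw']; omega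
    · intro w _ _ w' _ _ h
      exact add_right_cancel h
    · intro v hv hne
      have hvi : v i ≠ 0 := by
        intro h; simp [h] at hne
      have hv' : v - Pi.single i 1 + Pi.single i 1 = v := by
        funext j
        by_cases hj : j = i
        · subst hj; simp; omega
        · simp [hj]
      refine ⟨v - Pi.single i 1, ?_, ?_, hv'⟩
      · rw [mem_tuplesOfWeight] at hv ⊢
        have := hw (v - Pi.single i 1)
        rw [hv', hv] at this
        omega
      · rw [← ht, hv']
        exact hne
    · intro w _ _
      exact (ht w).symm
  · refine Finset.sum_eq_zero fun v hv => ?_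
    rw [mem_tuplesOfWeight] at hv
    have : ((i : ℕ) + 1) * v i ≤ tupleWeight v :=
      Finset.single_le_sum (f := fun i : Fin k => ((i : ℕ) + 1) * v i) (fun _ _ => Nat.zero_le _)
        (Finset.mem_univ i)
    have : v i = 0 := by
      by_contra h
      have : 1 ≤ v i := Nat.one_le_iff_ne_zero.mpr h
      nlinarith
    simp [this]

theorem orderKCoeff_recurrence (k : ℕ) (lam : ℝ) (m : ℕ) :
    (m : ℝ) * orderKCoeff k lam m = ∑ i ∈ Finset.range k,
      if i + 1 ≤ m then lam * ((i : ℝ) + 1) * orderKCoeff k lam (m - (i + 1)) else 0 := by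
  have h1 : (m : ℝ) * orderKCoeff k lam m =
      ∑ v ∈ tuplesOfWeight k m, ∑ i : Fin k, ((i : ℝ) + 1) * ((v i : ℝ) * tupleTerm lam v) := by
    rw [orderKCoeff, Finset.mul_sum]
    refine Finset.sum_congr rfl fun v hv => ?_
    rw [mem_tuplesOfWeight] at hv
    rw [← hv, tupleWeight]
    push_cast
    rw [Finset.sum_mul]
    exact Finset.sum_congr rfl fun i _ => by ring
  rw [h1, Finset.sum_comm, ← Fin.sum_univ_eq_sum_range (fun i => if i + 1 ≤ m then
    lam * ((i : ℝ) + 1) * orderKCoeff k lam (m - (i + 1)) else 0)]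
  refine Finset.sum_congr rfl fun i _ => ?_
  rw [← Finset.mul_sum, sum_mul_tupleTerm]
  split_ifs <;> ring

theorem orderKCoeff_pos {k : ℕ} (hk : 1 ≤ k) {lam : ℝ} (hlam : 0 < lam) (m : ℕ) :
    0 < orderKCoeff k lam m := by
  refine Finset.sum_pos (fun v _ => ?_) ⟨Pi.single ⟨0, hk⟩ m, ?_⟩
  · have : 0 < ((∏ i : Fin k, Nat.factorial (v i) : ℕ) : ℝ) := by
      exact_mod_cast Finset.prod_pos fun j _ => Nat.factorial_pos _
    unfold tupleTerm
    positivity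
  · rw [mem_tuplesOfWeight, tupleWeight, Finset.sum_eq_single ⟨0, hk⟩] <;>
      simp +contextual

theorem poissonOrderKPmf_eq_exp_mul_orderKCoeff (k : ℕ) (lam : ℝ) (m : ℕ) :
    poissonOrderKPmf k lam m = Real.exp (-(k * lam)) * orderKCoeff k lam m := by
  rw [poissonOrderKPmf, tsum_eq_sum (s := tuplesOfWeight k m), orderKCoeff]
  · congr 1
    exact Finset.sum_congr rfl fun v hv => if_pos (mem_tuplesOfWeight.mp hv)
  · intro v hv
    exact if_neg fun h => hv (mem_tuplesOfWeight.mpr h)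

/-- Chebyshev-type inequality from the Binet–Cauchy identity. -/
theorem sum_mul_sum_le_of_minors_nonneg {x y a b : ℕ → ℝ} {N : ℕ}
    (h : ∀ i < N, ∀ j < N, i < j → 0 ≤ (x i * y j - x j * y i) * (a i * b j - a j * b i)) :
    (∑ i ∈ Finset.range N, x i * b i) * (∑ i ∈ Finset.range N, y i * a i) ≤
      (∑ i ∈ Finset.range N, x i * a i) * (∑ i ∈ Finset.range N, y i * b i) := by
  have h0 : 0 ≤ ∑ i ∈ Finset.range N, ∑ j ∈ Finset.range N,
      (x i * y j - x j * y i) * (a i * b j - a j * b i) := by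
    refine Finset.sum_nonneg fun i hi => Finset.sum_nonneg fun j hj => ?_
    rw [Finset.mem_range] at hi hj
    rcases lt_trichotomy i j with hij | hij | hij
    · exact h i hi j hj hij
    · simp [hij]
    · have := h j hj i hi hij
      linarith
  have h1 : ∑ i ∈ Finset.range N, ∑ j ∈ Finset.range N,
      (x i * y j - x j * y i) * (a i * b j - a j * b i) =
      ∑ i ∈ Finset.range N, ∑ j ∈ Finset.range N, (x i * a i) * (y j * b j) -
      ∑ i ∈ Finset.range N, ∑ j ∈ Finset.range N, (x i * b i) * (y j * a j) -
      ∑ i ∈ Finset.range N, ∑ j ∈ Finset.range N, (y i * a i) * (x j * b j) +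
      ∑ i ∈ Finset.range N, ∑ j ∈ Finset.range N, (y i * b i) * (x j * a j) := by
    simp only [← Finset.sum_sub_distrib, ← Finset.sum_add_distrib]
    exact Finset.sum_congr rfl fun i _ => Finset.sum_congr rfl fun j _ => by ring
  rw [h1] at h0
  simp only [← Finset.sum_mul_sum] at h0
  linarith

theorem div_succ_antitone_of_logConcave {p : ℕ → ℝ} (hp : ∀ m, 0 < p m) {M : ℕ}
    (h : ∀ j < M, p j * p (j + 2) ≤ p (j + 1) ^ 2) {a b : ℕ} (hab : a ≤ b) (hb : b ≤ M) :
    p (b + 1) * p a ≤ p (a + 1) * p b := by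
  induction b, hab using Nat.le_induction with
  | base => exact le_rfl
  | succ b hab ih =>
    have h1 := ih (by omega)
    have h2 := h b (by omega)
    have := hp b
    have := hp (b + 1)
    have := hp (b + 2)
    have := hp a
    have h3 : p b * p (b + 2) * p a ≤ p b * (p (a + 1) * p (b + 1)) := by
      calc p b * p (b + 2) * p a ≤ p (b + 1) ^ 2 * p a := by gcongr
        _ = p (b + 1) * (p (b + 1) * p a) := by ring
        _ ≤ p (b + 1) * (p (a + 1) * p b) := by gcongr
        _ = _ := by ring
    rw [mul_assoc] at h3
    exact le_of_mul_le_mul_left h3 (hp b)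

/-- Hansen's criterion for log-concavity of a sequence given by a convolution recurrence. -/
theorem logConcave_of_recurrence {p r : ℕ → ℝ} (hp : ∀ m, 0 < p m)
    (hr : ∀ i j, i < j → r i * r (j + 1) ≤ r j * r (i + 1))
    (h01 : r 1 ≤ r 0 ^ 2)
    (hrec : ∀ m : ℕ, ((m : ℝ) + 1) * p (m + 1) = ∑ j ∈ Finset.range (m + 1), r j * p (m - j))
    (m : ℕ) : p m * p (m + 2) ≤ p (m + 1) ^ 2 := by
  have hr0 : p 1 = r 0 * p 0 := by simpa using hrec 0
  induction m using Nat.strong_induction_on with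
  | _ m ih =>
  rcases Nat.eq_zero_or_pos m with rfl | hm
  · have h2 := hrec 1
    simp only [Finset.sum_range_succ, Finset.sum_range_zero] at h2
    norm_num at h2
    have := mul_le_mul_of_nonneg_right h01 (sq_nonneg (p 0))
    have h3 : p 0 * (2 * p 2) = (r 0 * p 0) ^ 2 + r 1 * p 0 ^ 2 := by rw [h2, hr0]; ring
    simp only [zero_add]
    rw [hr0]
    nlinarith
  obtain ⟨q, hq⟩ : ∃ q : ℕ → ℝ, q = fun j => if j = 0 then 0 else p (j - 1) := ⟨_, rfl⟩
  have hq0 : q 0 = 0 := by simp [hq]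
  have hqs : ∀ j, q (j + 1) = p j := by simp [hq]
  have hanti := fun {a b : ℕ} => div_succ_antitone_of_logConcave hp (M := m) ih (a := a) (b := b)
  have key := sum_mul_sum_le_of_minors_nonneg (N := m + 1) (x := r) (y := fun j => r (j + 1))
    (a := fun j => p (m - j)) (b := fun j => q (m - j)) (by
      intro i hi j hj hij
      refine mul_nonneg_of_nonpos_of_nonpos (by linarith [hr i j hij]) ?_
      obtain ⟨t, ht⟩ : ∃ t, m - i = t + 1 := ⟨m - i - 1, by omega⟩
      simp only [ht, hqs]
      obtain hs | ⟨s, hs⟩ : m - j = 0 ∨ ∃ s, m - j = s + 1 := by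
        rcases Nat.eq_zero_or_pos (m - j) with h | h
        · exact Or.inl h
        · exact Or.inr ⟨m - j - 1, by omega⟩
      · rw [hs, hq0]
        have := mul_pos (hp 0) (hp t)
        linarith
      · rw [hs, hqs]
        have := hanti (a := s) (b := t) (by omega) (by omega)
        linarith)
  have e1 := hrec m
  have e2 : (m : ℝ) * p m = ∑ j ∈ Finset.range (m + 1), r j * q (m - j) := by
    obtain ⟨M, rfl⟩ : ∃ M, m = M + 1 := ⟨m - 1, by omega⟩
    rw [Finset.sum_range_succ, Nat.sub_self, hq0, mul_zero, add_zero]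
    push_cast
    rw [hrec M]
    refine Finset.sum_congr rfl fun j hj => ?_
    rw [Finset.mem_range] at hj
    rw [show M + 1 - j = (M - j) + 1 by omega, hqs]
  have e3 : ((m : ℝ) + 2) * p (m + 2) - r 0 * p (m + 1) =
      ∑ j ∈ Finset.range (m + 1), r (j + 1) * p (m - j) := by
    have := hrec (m + 1)
    rw [Finset.sum_range_succ'] at this
    push_cast at this
    rw [show ((m : ℝ) + 2) * p (m + 2) = (m + 1 + 1) * p (m + 1 + 1) by ring, this]
    ring
  have e4 : ((m : ℝ) + 1) * p (m + 1) - r 0 * p m =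
      ∑ j ∈ Finset.range (m + 1), r (j + 1) * q (m - j) := by
    rw [hrec m, Finset.sum_range_succ', Finset.sum_range_succ, Nat.sub_self, hq0]
    simp only [Nat.sub_zero, mul_zero, add_zero, add_sub_cancel_right]
    refine Finset.sum_congr rfl fun j hj => ?_
    rw [Finset.mem_range] at hj
    rw [show m - j = (m - (j + 1)) + 1 by omega, hqs]
  rw [← e1, ← e2, ← e3, ← e4] at key
  have h1 : p (m + 1) ≤ r 0 * p m := by
    have := hanti (a := 0) (b := m) (by omega) le_rfl
    simp only [zero_add] at this
    rw [hr0] at this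
    have h0 := hp 0
    nlinarith
  have h2 : p (m + 1) * p (m + 1) ≤ p (m + 1) * (r 0 * p m) :=
    mul_le_mul_of_nonneg_left h1 (hp _).le
  have hm' : (0 : ℝ) < m * (m + 2) := by positivity
  have h3 : (m : ℝ) * (m + 2) * (p m * p (m + 2)) ≤ m * (m + 2) * (p (m + 1) ^ 2) := by
    nlinarith
  exact le_of_mul_le_mul_left h3 hm'

theorem lt_of_logConcave_of_lt_neighbors {p : ℕ → ℝ} (hp : ∀ m, 0 < p m)
    (hlc : ∀ m, p m * p (m + 2) ≤ p (m + 1) ^ 2) {c : ℕ} (h1 : p c < p (c + 1))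
    (h2 : p (c + 2) < p (c + 1)) {j : ℕ} (hj : j ≠ c + 1) : p j < p (c + 1) := by
  have hanti := fun {a b : ℕ} (hab : a ≤ b) =>
    div_succ_antitone_of_logConcave hp (M := b) (fun j _ => hlc j) hab le_rfl
  rcases lt_or_gt_of_ne hj with h | h
  · have hinc : ∀ a ≤ c, p a < p (a + 1) := by
      intro a ha
      have := hanti ha
      have := hp a
      have := hp c
      by_contra hcon
      nlinarith
    have : ∀ d, d ≤ c → p (c - d) < p (c + 1) := by
      intro d
      induction d with
      | zero => intro _; simpa using h1
      | succ d ih =>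
        intro hd
        have := hinc (c - (d + 1)) (by omega)
        rw [show c - (d + 1) + 1 = c - d by omega] at this
        exact this.trans (ih (by omega))
    have := this (c - j) (by omega)
    rwa [show c - (c - j) = j by omega] at this
  · have hdec : ∀ a, c + 1 ≤ a → p (a + 1) < p a := by
      intro a ha
      have := hanti ha
      have := hp a
      have := hp (c + 1)
      by_contra hcon
      nlinarith
    have : ∀ d, p (c + 2 + d) < p (c + 1) := by
      intro d
      induction d with
      | zero => exact h2
      | succ d ih => exact (hdec (c + 2 + d) (by omega)).trans ih
    have := this (j - (c + 2))
    rwa [show c + 2 + (j - (c + 2)) = j by omega] at this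

/-- The real part of `λ Σ e^{ijt}`, `1 ≤ j ≤ k`. -/
noncomputable def cosSum (k : ℕ) (lam t : ℝ) : ℝ :=
  lam * ∑ j ∈ Finset.range k, Real.cos (((j : ℝ) + 1) * t)

/-- The imaginary part of `λ Σ e^{ijt}`, `1 ≤ j ≤ k`. -/
noncomputable def sinSum (k : ℕ) (lam t : ℝ) : ℝ :=
  lam * ∑ j ∈ Finset.range k, Real.sin (((j : ℝ) + 1) * t)

@[fun_prop]
theorem continuous_cosSum (k : ℕ) (lam : ℝ) : Continuous (cosSum k lam) := by
  unfold cosSum; fun_prop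

@[fun_prop]
theorem continuous_sinSum (k : ℕ) (lam : ℝ) : Continuous (sinSum k lam) := by
  unfold sinSum; fun_prop

theorem hasDerivAt_cosSum (k : ℕ) (lam t : ℝ) : HasDerivAt (cosSum k lam)
    (-(lam * ∑ j ∈ Finset.range k, ((j : ℝ) + 1) * Real.sin (((j : ℝ) + 1) * t))) t := by
  unfold cosSum
  have : ∀ j ∈ Finset.range k, HasDerivAt (fun t => Real.cos (((j : ℝ) + 1) * t))
      (-Real.sin (((j : ℝ) + 1) * t) * (((j : ℝ) + 1) * 1)) t := fun j _ =>
    ((hasDerivAt_id t).const_mul ((j : ℝ) + 1)).cos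
  refine ((HasDerivAt.fun_sum this).const_mul lam).congr_deriv ?_
  rw [← mul_neg, ← Finset.sum_neg_distrib]
  congr 1
  exact Finset.sum_congr rfl fun j _ => by ring

theorem hasDerivAt_sinSum (k : ℕ) (lam t : ℝ) : HasDerivAt (sinSum k lam)
    (lam * ∑ j ∈ Finset.range k, ((j : ℝ) + 1) * Real.cos (((j : ℝ) + 1) * t)) t := by
  unfold sinSum
  have : ∀ j ∈ Finset.range k, HasDerivAt (fun t => Real.sin (((j : ℝ) + 1) * t))
      (Real.cos (((j : ℝ) + 1) * t) * (((j : ℝ) + 1) * 1)) t := fun j _ =>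
    ((hasDerivAt_id t).const_mul ((j : ℝ) + 1)).sin
  refine ((HasDerivAt.fun_sum this).const_mul lam).congr_deriv ?_
  congr 1
  exact Finset.sum_congr rfl fun j _ => by ring

theorem sinSum_zero (k : ℕ) (lam : ℝ) : sinSum k lam 0 = 0 := by simp [sinSum]

theorem sinSum_pi (k : ℕ) (lam : ℝ) : sinSum k lam Real.pi = 0 := by
  have (j : ℕ) : Real.sin (((j : ℝ) + 1) * Real.pi) = 0 := by
    exact_mod_cast Real.sin_nat_mul_pi (j + 1)
  simp [sinSum, this]

/-- The Fourier integral representing the coefficients of `exp (λ Σ z^j)`. -/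
noncomputable def fourierCoeffInt (k : ℕ) (lam : ℝ) (m : ℤ) : ℝ :=
  ∫ t in (0 : ℝ)..Real.pi, Real.exp (cosSum k lam t) * Real.cos (sinSum k lam t - m * t)

theorem fourierCoeffInt_recurrence (k : ℕ) (lam : ℝ) (m : ℤ) :
    (m : ℝ) * fourierCoeffInt k lam m =
      ∑ j ∈ Finset.range k, lam * ((j : ℝ) + 1) * fourierCoeffInt k lam (m - (j + 1)) := by
  have hd : ∀ t : ℝ, HasDerivAt
      (fun t => Real.exp (cosSum k lam t) * Real.sin (sinSum k lam t - m * t))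
      ((∑ j ∈ Finset.range k, lam * ((j : ℝ) + 1) * (Real.exp (cosSum k lam t) *
        Real.cos (sinSum k lam t - ((m - (j + 1) : ℤ) : ℝ) * t))) -
        m * (Real.exp (cosSum k lam t) * Real.cos (sinSum k lam t - m * t))) t := by
    intro t
    refine ((hasDerivAt_cosSum k lam t).exp.mul
      (((hasDerivAt_sinSum k lam t).sub
        ((hasDerivAt_id t).const_mul (m : ℝ))).sin)).congr_deriv ?_
    have : ∀ j ∈ Finset.range k, lam * ((j : ℝ) + 1) * (Real.exp (cosSum k lam t) *
        Real.cos (sinSum k lam t - ((m - (j + 1) : ℤ) : ℝ) * t)) =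
        Real.exp (cosSum k lam t) * Real.cos (sinSum k lam t - m * t) *
          (lam * (((j : ℝ) + 1) * Real.cos (((j : ℝ) + 1) * t))) -
        Real.exp (cosSum k lam t) * Real.sin (sinSum k lam t - m * t) *
          (lam * (((j : ℝ) + 1) * Real.sin (((j : ℝ) + 1) * t))) := by
      intro j _
      push_cast
      rw [show sinSum k lam t - ((m : ℝ) - (j + 1)) * t =
        (sinSum k lam t - m * t) + ((j : ℝ) + 1) * t by ring, Real.cos_add]
      ring
    rw [Finset.sum_congr rfl this, Finset.sum_sub_distrib, ← Finset.mul_sum, ← Finset.mul_sum,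
      ← Finset.mul_sum, ← Finset.mul_sum]
    simp only [Pi.sub_apply, id]
    ring
  have hint := intervalIntegral.integral_eq_sub_of_hasDerivAt (a := 0) (b := Real.pi)
    (fun t _ => hd t) (Continuous.intervalIntegrable (by fun_prop) _ _)
  rw [sinSum_pi, sinSum_zero, intervalIntegral.integral_sub
    (Continuous.intervalIntegrable (by fun_prop) _ _)
    (Continuous.intervalIntegrable (by fun_prop) _ _),
    intervalIntegral.integral_finsetSum
    (fun j _ => Continuous.intervalIntegrable (by fun_prop) _ _)] at hint
  have hz : Real.sin (0 - (m : ℝ) * Real.pi) = 0 := by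
    rw [zero_sub, Real.sin_neg, Real.sin_int_mul_pi, neg_zero]
  simp only [intervalIntegral.integral_const_mul, hz] at hint
  simp only [mul_zero, sub_zero, Real.sin_zero] at hint
  unfold fourierCoeffInt
  linarith

theorem fourierCoeffInt_neg (k : ℕ) (lam : ℝ) (M : ℕ) :
    fourierCoeffInt k lam (-(M : ℤ)) = if M = 0 then Real.pi else 0 := by
  obtain ⟨f, hf⟩ : ∃ f : ℂ → ℂ, f = fun z =>
    z ^ M * Complex.exp (lam * ∑ j ∈ Finset.range k, z ^ (j + 1)) := ⟨_, rfl⟩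
  have hdiff : Differentiable ℂ f := by rw [hf]; fun_prop
  have havg := hdiff.diffContOnCl.circleAverage (c := 0) (R := 1)
  rw [Real.circleAverage_def] at havg
  have hre := congrArg Complex.re havg
  have hfre : ∀ t : ℝ, (f (circleMap 0 1 t)).re =
      Real.exp (cosSum k lam t) * Real.cos (sinSum k lam t - ((-(M : ℤ) : ℤ) : ℝ) * t) := by
    intro t
    have : f (circleMap 0 1 t) = Complex.exp (((cosSum k lam t : ℝ) : ℂ) +
        ((sinSum k lam t + M * t : ℝ) : ℂ) * Complex.I) := by
      rw [hf]
      simp only [circleMap, zero_add, Complex.ofReal_one, one_mul, ← Complex.exp_nat_mul,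
        ← Complex.exp_add]
      congr 1
      have : ∀ j ∈ Finset.range k, Complex.exp (((j + 1 : ℕ) : ℂ) * (t * Complex.I)) =
          ((Real.cos (((j : ℝ) + 1) * t) : ℝ) : ℂ) +
          ((Real.sin (((j : ℝ) + 1) * t) : ℝ) : ℂ) * Complex.I := by
        intro j _
        rw [← mul_assoc, Complex.exp_mul_I]
        push_cast
        rfl
      rw [Finset.sum_congr rfl this, Finset.sum_add_distrib, ← Finset.sum_mul]
      simp only [cosSum, sinSum]
      push_cast
      ring
    rw [this, Complex.exp_re]
    simp
  have hcont : Continuous fun t : ℝ => f (circleMap 0 1 t) := by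
    rw [hf]; fun_prop
  have hsymm : ∫ t in (0 : ℝ)..2 * Real.pi, Real.exp (cosSum k lam t) *
      Real.cos (sinSum k lam t - ((-(M : ℤ) : ℤ) : ℝ) * t) =
      2 * fourierCoeffInt k lam (-(M : ℤ)) := by
    obtain ⟨g, hg⟩ : ∃ g : ℝ → ℝ, g = fun t => Real.exp (cosSum k lam t) *
      Real.cos (sinSum k lam t - ((-(M : ℤ) : ℤ) : ℝ) * t) := ⟨_, rfl⟩
    have hgc : Continuous g := by rw [hg]; fun_prop
    have hrefl : ∀ t, g (2 * Real.pi - t) = g t := by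
      intro t
      have hc (j : ℕ) : Real.cos (((j : ℝ) + 1) * (2 * Real.pi - t)) =
          Real.cos (((j : ℝ) + 1) * t) := by
        rw [show ((j : ℝ) + 1) * (2 * Real.pi - t) =
          ((j + 1 : ℕ) : ℝ) * (2 * Real.pi) - ((j : ℝ) + 1) * t by push_cast; ring,
          Real.cos_nat_mul_two_pi_sub]
      have hs (j : ℕ) : Real.sin (((j : ℝ) + 1) * (2 * Real.pi - t)) =
          -Real.sin (((j : ℝ) + 1) * t) := by
        rw [show ((j : ℝ) + 1) * (2 * Real.pi - t) =
          ((j + 1 : ℕ) : ℝ) * (2 * Real.pi) - ((j : ℝ) + 1) * t by push_cast; ring,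
          Real.sin_nat_mul_two_pi_sub]
      have hC : cosSum k lam (2 * Real.pi - t) = cosSum k lam t := by simp only [cosSum, hc]
      have hS : sinSum k lam (2 * Real.pi - t) = -sinSum k lam t := by
        simp only [sinSum, hs, Finset.sum_neg_distrib, mul_neg]
      simp only [hg, hC, hS]
      rw [show -sinSum k lam t - ((-(M : ℤ) : ℤ) : ℝ) * (2 * Real.pi - t) =
        (M : ℝ) * (2 * Real.pi) - (sinSum k lam t - ((-(M : ℤ) : ℤ) : ℝ) * t) by push_cast; ring,
        Real.cos_nat_mul_two_pi_sub]
    have h1 : ∫ t in Real.pi..2 * Real.pi, g t = ∫ t in (0 : ℝ)..Real.pi, g t := by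
      have := intervalIntegral.integral_comp_sub_left (a := 0) (b := Real.pi) g (2 * Real.pi)
      simp only [hrefl] at this
      rw [this]
      congr 1 <;> ring
    have h2 := intervalIntegral.integral_add_adjacent_intervals (μ := MeasureTheory.volume)
      (hgc.intervalIntegrable 0 Real.pi) (hgc.intervalIntegrable Real.pi (2 * Real.pi))
    rw [h1] at h2
    rw [fourierCoeffInt, ← hg, ← h2]
    ring
  have hcomm := Complex.reCLM.intervalIntegral_comp_comm
    (hcont.intervalIntegrable (μ := MeasureTheory.volume) 0 (2 * Real.pi))
  simp only [Complex.reCLM_apply, hfre] at hcomm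
  rw [hsymm] at hcomm
  rw [Complex.smul_re, ← hcomm, smul_eq_mul] at hre
  have hf0 : (f 0).re = if M = 0 then 1 else 0 := by
    rw [hf]
    by_cases hM : M = 0 <;> simp [hM]
  rw [hf0] at hre
  have hpi := Real.pi_pos
  have : fourierCoeffInt k lam (-(M : ℤ)) = Real.pi * if M = 0 then (1 : ℝ) else 0 := by
    rw [← hre]; field_simp
  rw [this]
  split_ifs <;> simp

theorem fourierCoeffInt_eq_pi_mul_orderKCoeff (k : ℕ) (lam : ℝ) (m : ℕ) :
    fourierCoeffInt k lam m = Real.pi * orderKCoeff k lam m := by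
  induction m using Nat.strong_induction_on with
  | _ m ih =>
  rcases Nat.eq_zero_or_pos m with rfl | hm
  · simpa [orderKCoeff_zero] using fourierCoeffInt_neg k lam 0
  have hm' : (m : ℝ) ≠ 0 := by positivity
  have h1 := fourierCoeffInt_recurrence k lam m
  have h2 := orderKCoeff_recurrence k lam m
  have h3 : ∑ j ∈ Finset.range k,
      lam * ((j : ℝ) + 1) * fourierCoeffInt k lam ((m : ℤ) - (j + 1)) =
      Real.pi * ∑ i ∈ Finset.range k, if i + 1 ≤ m then
        lam * ((i : ℝ) + 1) * orderKCoeff k lam (m - (i + 1)) else 0 := by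
    rw [Finset.mul_sum]
    refine Finset.sum_congr rfl fun j _ => ?_
    split_ifs with hj
    · rw [show (m : ℤ) - (j + 1) = ((m - (j + 1) : ℕ) : ℤ) by omega, ih _ (by omega)]
      ring
    · rw [show (m : ℤ) - (j + 1) = -((j + 1 - m : ℕ) : ℤ) by omega, fourierCoeffInt_neg,
        if_neg (by omega)]
      ring
  rw [h3, ← h2] at h1
  push_cast at h1
  exact mul_left_cancel₀ hm' (by rw [h1]; ring)

theorem nonneg_of_hasDerivAt_nonneg {f f' : ℝ → ℝ} (hf : ∀ x, HasDerivAt f (f' x) x)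
    (hf' : ∀ x, 0 ≤ x → 0 ≤ f' x) (h0 : f 0 = 0) {x : ℝ} (hx : 0 ≤ x) : 0 ≤ f x := by
  have hmono : MonotoneOn f (Set.Ici 0) :=
    monotoneOn_of_deriv_nonneg (convex_Ici 0)
      (fun x _ => (hf x).continuousAt.continuousWithinAt)
      (fun x _ => (hf x).differentiableAt.differentiableWithinAt)
      (fun x hx => by
        rw [interior_Ici, Set.mem_Ioi] at hx
        rw [(hf x).deriv]
        exact hf' x hx.le)
  have := hmono (Set.mem_Ici.mpr le_rfl) (Set.mem_Ici.mpr hx) hx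
  rwa [h0] at this

theorem cos_le_taylor_four {x : ℝ} (hx : 0 ≤ x) : Real.cos x ≤ 1 - x ^ 2 / 2 + x ^ 4 / 24 := by
  have := nonneg_of_hasDerivAt_nonneg (f := fun x => 1 - x ^ 2 / 2 + x ^ 4 / 24 - Real.cos x)
    (f' := fun x => Real.sin x - (x - x ^ 3 / 6)) (fun x => by
      refine (((((hasDerivAt_id x).pow 2).div_const 2).const_sub 1).add
        (((hasDerivAt_id x).pow 4).div_const 24)).sub (Real.hasDerivAt_cos x) |>.congr_deriv ?_
      simp only [id]; norm_num; ring)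
    (fun x hx => by linarith [Real.sin_ge_sub_cube hx]) (by simp) hx
  linarith

theorem sin_le_taylor_five {x : ℝ} (hx : 0 ≤ x) :
    Real.sin x ≤ x - x ^ 3 / 6 + x ^ 5 / 120 := by
  have := nonneg_of_hasDerivAt_nonneg (f := fun x => x - x ^ 3 / 6 + x ^ 5 / 120 - Real.sin x)
    (f' := fun x => 1 - x ^ 2 / 2 + x ^ 4 / 24 - Real.cos x) (fun x => by
      refine ((((hasDerivAt_id x).sub (((hasDerivAt_id x).pow 3).div_const 6)).add
        (((hasDerivAt_id x).pow 5).div_const 120)).sub (Real.hasDerivAt_sin x)).congr_deriv ?_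
      simp only [id]; norm_num; ring)
    (fun x hx => by linarith [cos_le_taylor_four hx]) (by simp) hx
  linarith

theorem taylor_six_le_cos {x : ℝ} (hx : 0 ≤ x) :
    1 - x ^ 2 / 2 + x ^ 4 / 24 - x ^ 6 / 720 ≤ Real.cos x := by
  have := nonneg_of_hasDerivAt_nonneg
    (f := fun x => Real.cos x - (1 - x ^ 2 / 2 + x ^ 4 / 24 - x ^ 6 / 720))
    (f' := fun x => x - x ^ 3 / 6 + x ^ 5 / 120 - Real.sin x) (fun x => by
      refine ((Real.hasDerivAt_cos x).sub (((((((hasDerivAt_id x).pow 2).div_const 2).const_sub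
        1).add (((hasDerivAt_id x).pow 4).div_const 24))).sub
        (((hasDerivAt_id x).pow 6).div_const 720))).congr_deriv ?_
      simp only [id]; norm_num; ring)
    (fun x hx => by linarith [sin_le_taylor_five hx]) (by simp) hx
  linarith

theorem abs_sin_sub_taylor_le (x : ℝ) :
    |Real.sin x - (x - x ^ 3 / 6)| ≤ |x| ^ 5 / 120 := by
  have key : ∀ x : ℝ, 0 ≤ x → |Real.sin x - (x - x ^ 3 / 6)| ≤ x ^ 5 / 120 := by
    intro x hx
    rw [abs_of_nonneg (by linarith [Real.sin_ge_sub_cube hx])]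
    linarith [sin_le_taylor_five hx]
  rcases le_total 0 x with h | h
  · rw [abs_of_nonneg h]; exact key x h
  · have := key (-x) (by linarith)
    rw [Real.sin_neg] at this
    rw [abs_of_nonpos h, ← abs_neg]
    convert this using 2
    ring

theorem abs_cos_sub_taylor_le (x : ℝ) :
    |Real.cos x - (1 - x ^ 2 / 2 + x ^ 4 / 24)| ≤ x ^ 6 / 720 := by
  have key : ∀ x : ℝ, 0 ≤ x → |Real.cos x - (1 - x ^ 2 / 2 + x ^ 4 / 24)| ≤ x ^ 6 / 720 := by
    intro x hx
    rw [abs_le]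
    constructor <;> linarith [taylor_six_le_cos hx, cos_le_taylor_four hx,
      pow_nonneg hx 6]
  rcases le_total 0 x with h | h
  · exact key x h
  · have := key (-x) (by linarith)
    rw [Real.cos_neg] at this
    convert this using 2 <;> ring

theorem neg_sin_le_div_four {x : ℝ} (hx : 0 ≤ x) : -Real.sin x ≤ x / 4 := by
  have hp := Real.pi_gt_d2
  rcases le_or_gt x Real.pi with h | h
  · linarith [Real.sin_nonneg_of_nonneg_of_le_pi hx h]
  · rcases le_or_gt x 4 with h4 | h4
    · have := Real.sin_le (x := x - Real.pi) (by linarith)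
      rw [Real.sin_sub_pi] at this
      linarith
    · linarith [Real.neg_one_le_sin x]

section PowerSums

variable (k : ℕ)

theorem sum_succ_pow_one : ∑ j ∈ Finset.range k, ((j : ℝ) + 1) = (k : ℝ) * (k + 1) / 2 := by
  induction k with
  | zero => simp
  | succ k ih => rw [Finset.sum_range_succ, ih]; push_cast; ring

theorem sum_succ_pow_two :
    ∑ j ∈ Finset.range k, ((j : ℝ) + 1) ^ 2 = (k : ℝ) * (k + 1) * (2 * k + 1) / 6 := by
  induction k with
  | zero => simp
  | succ k ih => rw [Finset.sum_range_succ, ih]; push_cast; ring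

theorem sum_succ_pow_three :
    ∑ j ∈ Finset.range k, ((j : ℝ) + 1) ^ 3 = ((k : ℝ) * (k + 1)) ^ 2 / 4 := by
  induction k with
  | zero => simp
  | succ k ih => rw [Finset.sum_range_succ, ih]; push_cast; ring

theorem sum_succ_pow_four : ∑ j ∈ Finset.range k, ((j : ℝ) + 1) ^ 4 =
    (k : ℝ) * (k + 1) * (2 * k + 1) * (3 * (k * (k + 1)) - 1) / 30 := by
  induction k with
  | zero => simp
  | succ k ih => rw [Finset.sum_range_succ, ih]; push_cast; ring

theorem sum_succ_pow_five : ∑ j ∈ Finset.range k, ((j : ℝ) + 1) ^ 5 =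
    ((k : ℝ) * (k + 1)) ^ 2 * (2 * (k * (k + 1)) - 1) / 12 := by
  induction k with
  | zero => simp
  | succ k ih => rw [Finset.sum_range_succ, ih]; push_cast; ring

end PowerSums

/-- The damping exponent `λ Σ (1 - cos jt)`. -/
noncomputable def damping (k : ℕ) (lam t : ℝ) : ℝ :=
  lam * ∑ j ∈ Finset.range k, (1 - Real.cos (((j : ℝ) + 1) * t))

/-- The phase `λ Σ (jt - sin jt)`. -/
noncomputable def phase (k : ℕ) (lam t : ℝ) : ℝ :=
  lam * ∑ j ∈ Finset.range k, (((j : ℝ) + 1) * t - Real.sin (((j : ℝ) + 1) * t))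

@[fun_prop]
theorem continuous_damping (k : ℕ) (lam : ℝ) : Continuous (damping k lam) := by
  unfold damping; fun_prop

@[fun_prop]
theorem continuous_phase (k : ℕ) (lam : ℝ) : Continuous (phase k lam) := by
  unfold phase; fun_prop

theorem hasDerivAt_damping (k : ℕ) (lam t : ℝ) : HasDerivAt (damping k lam)
    (lam * ∑ j ∈ Finset.range k, ((j : ℝ) + 1) * Real.sin (((j : ℝ) + 1) * t)) t := by
  have h : damping k lam = fun t => lam * k - cosSum k lam t := by
    funext t
    simp only [damping, cosSum, Finset.sum_sub_distrib, Finset.sum_const, Finset.card_range,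
      nsmul_eq_mul]
    ring
  rw [h]
  exact ((hasDerivAt_cosSum k lam t).const_sub _).congr_deriv (by ring)

section Bounds

variable {k : ℕ} {lam K h t : ℝ}

theorem damping_le (hK : K = (k : ℝ) * (k + 1)) (hh : h = (k : ℝ) + 1 / 2) (hlam : 0 ≤ lam) :
    damping k lam t ≤ lam * K * h / 6 * t ^ 2 := by
  have h1 : ∑ j ∈ Finset.range k, (1 - Real.cos (((j : ℝ) + 1) * t)) ≤
      ∑ j ∈ Finset.range k, ((j : ℝ) + 1) ^ 2 * (t ^ 2 / 2) :=
    Finset.sum_le_sum fun j _ => by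
      have := Real.one_sub_sq_div_two_le_cos (x := ((j : ℝ) + 1) * t)
      nlinarith
  rw [← Finset.sum_mul, sum_succ_pow_two] at h1
  have := mul_le_mul_of_nonneg_left h1 hlam
  unfold damping
  refine this.trans_eq ?_
  rw [hK, hh]; ring

theorem damping_nonneg (hlam : 0 ≤ lam) : 0 ≤ damping k lam t :=
  mul_nonneg hlam (Finset.sum_nonneg fun j _ => by linarith [Real.cos_le_one (((j : ℝ) + 1) * t)])

theorem le_deriv_damping (hK : K = (k : ℝ) * (k + 1)) (hh : h = (k : ℝ) + 1 / 2) (hlam : 0 ≤ lam)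
    (ht : 0 ≤ t) : lam * K * h / 3 * t * (1 - K * t ^ 2 / 10) ≤
      lam * ∑ j ∈ Finset.range k, ((j : ℝ) + 1) * Real.sin (((j : ℝ) + 1) * t) := by
  have h1 : ∑ j ∈ Finset.range k, (((j : ℝ) + 1) ^ 2 * t - ((j : ℝ) + 1) ^ 4 * (t ^ 3 / 6)) ≤
      ∑ j ∈ Finset.range k, ((j : ℝ) + 1) * Real.sin (((j : ℝ) + 1) * t) :=
    Finset.sum_le_sum fun j _ => by
      have h2 := Real.sin_ge_sub_cube (x := ((j : ℝ) + 1) * t) (by positivity)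
      have h3 := mul_le_mul_of_nonneg_left h2 (show 0 ≤ (j : ℝ) + 1 by positivity)
      linarith
  rw [Finset.sum_sub_distrib, ← Finset.sum_mul, ← Finset.sum_mul, sum_succ_pow_two,
    sum_succ_pow_four] at h1
  refine le_trans ?_ (mul_le_mul_of_nonneg_left h1 hlam)
  have : 0 ≤ lam * K * h / 90 * t ^ 3 := by rw [hK, hh]; positivity
  rw [hK, hh] at this ⊢
  linarith

theorem two_sin_mul_sum_cos (k : ℕ) (t : ℝ) :
    2 * Real.sin (t / 2) * ∑ j ∈ Finset.range k, Real.cos (((j : ℝ) + 1) * t) =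
      Real.sin (((k : ℝ) + 1 / 2) * t) - Real.sin (t / 2) := by
  induction k with
  | zero => simp; ring_nf
  | succ k ih =>
    rw [Finset.sum_range_succ, mul_add, ih]
    push_cast
    rw [show ((k : ℝ) + 1 / 2) * t = (k + 1) * t - t / 2 by ring,
      show ((k : ℝ) + 1 + 1 / 2) * t = (k + 1) * t + t / 2 by ring, Real.sin_add, Real.sin_sub]
    ring

theorem le_damping_of_le (hk : 2 ≤ k) (hK : K = (k : ℝ) * (k + 1)) (hh : h = (k : ℝ) + 1 / 2)
    (hlam : 0 ≤ lam) {t₀ : ℝ} (ht₀ : 0 < t₀) (hKt : K * t₀ ^ 2 = 6) (htt : t₀ ≤ t)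
    (htpi : t ≤ Real.pi) : 0.58 * (lam * h) ≤ damping k lam t := by
  have hk' : (2 : ℝ) ≤ k := by exact_mod_cast hk
  have hh2 : h ^ 2 = K + 1 / 4 := by rw [hK, hh]; ring
  have hK6 : 6 ≤ K := by rw [hK]; nlinarith
  have hhpos : 0 < h := by linarith
  have ht1 : t₀ ≤ 1 := by nlinarith
  have hs : Real.sin (t₀ / 2) ≤ Real.sin (t / 2) :=
    Real.sin_le_sin_of_le_of_le_pi_div_two (by linarith [Real.pi_pos]) (by linarith) (by linarith)
  have hs0 := Real.sin_ge_sub_cube (x := t₀ / 2) (by linarith)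
  have hX : (2.381 : ℝ) ≤ h * t₀ * (1 - t₀ ^ 2 / 24) := by
    have h1 : (h * t₀) ^ 2 = 6 + t₀ ^ 2 / 4 := by rw [mul_pow, hh2]; linarith
    have h2 : 0 ≤ h * t₀ * (1 - t₀ ^ 2 / 24) :=
      mul_nonneg (by positivity) (by nlinarith)
    refine (pow_le_pow_iff_left₀ (by norm_num) h2 two_ne_zero).mp ?_
    rw [mul_pow, h1]
    have : t₀ ^ 2 ≤ 1 := by nlinarith
    nlinarith [sq_nonneg t₀, mul_nonneg (sq_nonneg t₀) (sub_nonneg.mpr this)]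
  have hX2 : (2.381 : ℝ) ≤ 2 * h * Real.sin (t / 2) := by nlinarith
  have hspos : 0 < 2 * Real.sin (t / 2) := by nlinarith
  have hsum : ∑ j ∈ Finset.range k, Real.cos (((j : ℝ) + 1) * t) ≤ 0.42 * h - 1 / 2 := by
    refine le_of_mul_le_mul_left ?_ hspos
    rw [two_sin_mul_sum_cos]
    have := Real.sin_le_one (((k : ℝ) + 1 / 2) * t)
    linarith
  unfold damping
  rw [Finset.sum_sub_distrib]
  simp only [Finset.sum_const, Finset.card_range, nsmul_eq_mul, mul_one]
  nlinarith [mul_le_mul_of_nonneg_left hsum hlam]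

theorem phase_nonneg (hlam : 0 ≤ lam) (ht : 0 ≤ t) : 0 ≤ phase k lam t :=
  mul_nonneg hlam (Finset.sum_nonneg fun j _ => by
    linarith [Real.sin_le (x := ((j : ℝ) + 1) * t) (by positivity)])

theorem phase_le (hK : K = (k : ℝ) * (k + 1)) (hlam : 0 ≤ lam) (ht : 0 ≤ t) :
    phase k lam t ≤ lam * K ^ 2 / 24 * t ^ 3 := by
  have h1 : ∑ j ∈ Finset.range k, (((j : ℝ) + 1) * t - Real.sin (((j : ℝ) + 1) * t)) ≤
      ∑ j ∈ Finset.range k, ((j : ℝ) + 1) ^ 3 * (t ^ 3 / 6) :=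
    Finset.sum_le_sum fun j _ => by
      have := Real.sin_ge_sub_cube (x := ((j : ℝ) + 1) * t) (by positivity)
      linarith
  rw [← Finset.sum_mul, sum_succ_pow_three] at h1
  refine (mul_le_mul_of_nonneg_left h1 hlam).trans_eq ?_
  rw [hK]; ring

theorem le_phase (hK : K = (k : ℝ) * (k + 1)) (hlam : 0 ≤ lam) (ht : 0 ≤ t)
    (hKt : K * t ^ 2 ≤ 6) : 0.8 * (lam * K ^ 2 / 24 * t ^ 3) ≤ phase k lam t := by
  have h1 : ∑ j ∈ Finset.range k,
      (((j : ℝ) + 1) ^ 3 * (t ^ 3 / 6) - ((j : ℝ) + 1) ^ 5 * (t ^ 5 / 120)) ≤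
      ∑ j ∈ Finset.range k, (((j : ℝ) + 1) * t - Real.sin (((j : ℝ) + 1) * t)) :=
    Finset.sum_le_sum fun j _ => by
      have := sin_le_taylor_five (x := ((j : ℝ) + 1) * t) (by positivity)
      linarith
  rw [Finset.sum_sub_distrib, ← Finset.sum_mul, ← Finset.sum_mul, sum_succ_pow_three,
    sum_succ_pow_five, ← hK] at h1
  refine le_trans ?_ (mul_le_mul_of_nonneg_left h1 hlam)
  have h2 : 0 ≤ lam * K ^ 2 * t ^ 3 * (6 - K * t ^ 2) :=
    mul_nonneg (by positivity) (by linarith)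
  have h3 : 0 ≤ lam * K ^ 2 * t ^ 5 := by positivity
  linarith

end Bounds

section Stein

variable {k : ℕ} {K h δ t : ℝ}

/-- The coefficient of the sine of the centered phase in the Stein identity. -/
noncomputable def steinSin (k : ℕ) (δ t : ℝ) : ℝ :=
  ∑ j ∈ Finset.range k, ((j : ℝ) + 1) * (Real.sin (((j : ℝ) + 1 - δ) * t) + Real.sin (δ * t))

/-- The coefficient of the cosine of the centered phase in the Stein identity. -/
noncomputable def steinCos (k : ℕ) (δ t : ℝ) : ℝ :=
  ∑ j ∈ Finset.range k, ((j : ℝ) + 1) * (Real.cos (δ * t) - Real.cos (((j : ℝ) + 1 - δ) * t))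

@[fun_prop]
theorem continuous_steinSin (k : ℕ) (δ : ℝ) : Continuous (steinSin k δ) := by
  unfold steinSin; fun_prop

@[fun_prop]
theorem continuous_steinCos (k : ℕ) (δ : ℝ) : Continuous (steinCos k δ) := by
  unfold steinCos; fun_prop

theorem abs_succ_sub_le (hK : K = (k : ℝ) * (k + 1)) (hh : h = (k : ℝ) + 1 / 2)
    (hδ : δ * (8 * h) = 3 * K) {j : ℕ} (hj : j < k) :
    |(j : ℝ) + 1 - δ| ≤ 0.625 * h ∧ 0 ≤ δ ∧ δ ≤ 0.375 * h := by
  have hj1 : (j : ℝ) + 1 ≤ k := by exact_mod_cast hj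
  have hj0 : (0 : ℝ) ≤ j := Nat.cast_nonneg j
  have hpos : 0 < h := by linarith
  have hKh : K = h ^ 2 - 1 / 4 := by rw [hK, hh]; ring
  have hδ0 : 0 ≤ δ := by
    by_contra hcon
    have : K < 0 := by nlinarith
    nlinarith
  have hδ1 : δ ≤ 0.375 * h := by
    by_contra hcon
    nlinarith
  have hδ2 : 0.375 * h - 0.375 ≤ δ := by
    by_contra hcon
    nlinarith
  refine ⟨abs_le.mpr ⟨by linarith, by linarith⟩, hδ0, hδ1⟩

theorem abs_sinPart_sub_le (hk : 2 ≤ k) (hK : K = (k : ℝ) * (k + 1))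
    (hh : h = (k : ℝ) + 1 / 2) (hδ : δ * (8 * h) = 3 * K) (ht : 0 ≤ t) :
    |K * h / 3 * (2 * Real.sin (t / 2)) - steinSin k δ t -
      K * h / 3 * ((3 * K - 1) / 30 - 1 / 24 - δ ^ 2 / 2) * t ^ 3| ≤
      K * h / 3 * (0.00131 * h ^ 4 * t ^ 5) := by
  have hk' : (2 : ℝ) ≤ k := by exact_mod_cast hk
  have hhpos : 2.5 ≤ h := by linarith
  have hKpos : 0 < K := by rw [hK]; positivity
  have hterm : ∀ j ∈ Finset.range k, |((j : ℝ) + 1) * ((Real.sin (((j : ℝ) + 1 - δ) * t) -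
      (((j : ℝ) + 1 - δ) * t - (((j : ℝ) + 1 - δ) * t) ^ 3 / 6)) +
      (Real.sin (δ * t) - (δ * t - (δ * t) ^ 3 / 6)))| ≤
      ((j : ℝ) + 1) * (0.103 * h ^ 5 * t ^ 5 / 120) := by
    intro j hj
    obtain ⟨h1, h2, h3⟩ := abs_succ_sub_le hK hh hδ (Finset.mem_range.mp hj)
    rw [abs_mul, abs_of_nonneg (by positivity : 0 ≤ (j : ℝ) + 1)]
    refine mul_le_mul_of_nonneg_left ?_ (by positivity)
    refine (abs_add_le _ _).trans ?_
    have a1 := abs_sin_sub_taylor_le (((j : ℝ) + 1 - δ) * t)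
    have a2 := abs_sin_sub_taylor_le (δ * t)
    rw [abs_mul, abs_of_nonneg ht] at a1
    rw [abs_of_nonneg (show 0 ≤ δ * t by positivity)] at a2
    have b1 : (|(j : ℝ) + 1 - δ| * t) ^ 5 ≤ (0.625 * h * t) ^ 5 := by gcongr
    have b2 : (δ * t) ^ 5 ≤ (0.375 * h * t) ^ 5 := by gcongr
    have : 0 ≤ (h * t) ^ 5 := by positivity
    calc _ ≤ _ := add_le_add a1 a2
      _ ≤ (0.625 * h * t) ^ 5 / 120 + (0.375 * h * t) ^ 5 / 120 := by gcongr
      _ ≤ _ := by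
        rw [mul_assoc (0.625 : ℝ), mul_assoc (0.375 : ℝ), mul_pow (0.625 : ℝ),
          mul_pow (0.375 : ℝ), mul_assoc (0.103 : ℝ), ← mul_pow]
        linarith
  have hsum := (Finset.abs_sum_le_sum_abs _ _).trans (Finset.sum_le_sum hterm)
  rw [← Finset.sum_mul, sum_succ_pow_one, ← hK] at hsum
  have hid : ∑ j ∈ Finset.range k, ((j : ℝ) + 1) * ((Real.sin (((j : ℝ) + 1 - δ) * t) -
      (((j : ℝ) + 1 - δ) * t - (((j : ℝ) + 1 - δ) * t) ^ 3 / 6)) +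
      (Real.sin (δ * t) - (δ * t - (δ * t) ^ 3 / 6))) =
      steinSin k δ t - (K * h / 3 * t - t ^ 3 / 6 * (K * h / 3 * ((3 * K - 1) / 5) -
        3 * δ * (K ^ 2 / 4) + 3 * δ ^ 2 * (K * h / 3))) := by
    have e2 : K * h / 3 = ∑ j ∈ Finset.range k, ((j : ℝ) + 1) ^ 2 := by
      rw [sum_succ_pow_two, hK, hh]; ring
    have e3 : K ^ 2 / 4 = ∑ j ∈ Finset.range k, ((j : ℝ) + 1) ^ 3 := by
      rw [sum_succ_pow_three, hK]
    have e4 : K * h / 3 * ((3 * K - 1) / 5) = ∑ j ∈ Finset.range k, ((j : ℝ) + 1) ^ 4 := by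
      rw [sum_succ_pow_four, hK, hh]; ring
    rw [e4, e3, e2, steinSin]
    simp only [Finset.mul_sum, Finset.sum_mul, ← Finset.sum_sub_distrib, ← Finset.sum_add_distrib]
    exact Finset.sum_congr rfl fun j _ => by ring
  rw [hid] at hsum
  have hτ := abs_sin_sub_taylor_le (t / 2)
  rw [abs_of_nonneg (show 0 ≤ t / 2 by positivity)] at hτ
  have hS : 0 ≤ K * h / 3 := by positivity
  have hδ' : 3 * δ * (K ^ 2 / 4) = K * h / 3 * (6 * δ ^ 2) := by
    linear_combination (-(1 / 4)) * K * δ * hδ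
  have hsplit : K * h / 3 * (2 * Real.sin (t / 2)) - steinSin k δ t -
      K * h / 3 * ((3 * K - 1) / 30 - 1 / 24 - δ ^ 2 / 2) * t ^ 3 =
      K * h / 3 * (2 * (Real.sin (t / 2) - (t / 2 - (t / 2) ^ 3 / 6))) -
      (steinSin k δ t - (K * h / 3 * t - t ^ 3 / 6 * (K * h / 3 * ((3 * K - 1) / 5) -
        3 * δ * (K ^ 2 / 4) + 3 * δ ^ 2 * (K * h / 3)))) := by
    rw [hδ']; ring
  rw [hsplit]
  refine (abs_sub _ _).trans ?_
  rw [abs_mul, abs_mul, abs_of_nonneg hS, abs_of_pos (by norm_num : (0 : ℝ) < 2)]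
  have h4 : (39 : ℝ) ≤ h ^ 4 := by
    have : (2.5 : ℝ) ^ 4 ≤ h ^ 4 := by gcongr
    norm_num at this; linarith
  have hKt : 0 ≤ K * h / 3 * t ^ 5 := by positivity
  have h5 : K * h / 3 * (2 * |Real.sin (t / 2) - (t / 2 - (t / 2) ^ 3 / 6)|) ≤
      K * h / 3 * t ^ 5 * (1 / 1920) := by
    have := mul_le_mul_of_nonneg_left hτ hS
    linarith
  have h6 : K / 2 * (0.103 * (h : ℝ) ^ 5 * t ^ 5 / 120) =
      K * h / 3 * t ^ 5 * (0.0012875 * h ^ 4) := by ring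
  have h8 : K * h / 3 * t ^ 5 * (1 / 1920 + 0.0012875 * h ^ 4) ≤
      K * h / 3 * t ^ 5 * (0.00131 * h ^ 4) :=
    mul_le_mul_of_nonneg_left (by linarith) hKt
  linarith

theorem abs_steinCos_le (hk : 2 ≤ k) (hK : K = (k : ℝ) * (k + 1))
    (hh : h = (k : ℝ) + 1 / 2) (hδ : δ * (8 * h) = 3 * K) (ht : 0 ≤ t) :
    |steinCos k δ t| ≤ K * h / 3 * (0.00092 * K ^ 2 / h * t ^ 4 + 0.000131 * h ^ 5 * t ^ 6) := by
  have hk' : (2 : ℝ) ≤ k := by exact_mod_cast hk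
  have hhpos : 2.5 ≤ h := by linarith
  have hh0 : 0 < h := by linarith
  have hKpos : 6 ≤ K := by rw [hK]; nlinarith
  have hh2 : h ^ 2 = K + 1 / 4 := by rw [hK, hh]; ring
  have hterm : ∀ j ∈ Finset.range k, |((j : ℝ) + 1) *
      ((Real.cos (δ * t) - (1 - (δ * t) ^ 2 / 2 + (δ * t) ^ 4 / 24)) -
      (Real.cos (((j : ℝ) + 1 - δ) * t) - (1 - (((j : ℝ) + 1 - δ) * t) ^ 2 / 2 +
        (((j : ℝ) + 1 - δ) * t) ^ 4 / 24)))| ≤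
      ((j : ℝ) + 1) * (0.0625 * h ^ 6 * t ^ 6 / 720) := by
    intro j hj
    obtain ⟨h1, h2, h3⟩ := abs_succ_sub_le hK hh hδ (Finset.mem_range.mp hj)
    rw [abs_mul, abs_of_nonneg (by positivity : 0 ≤ (j : ℝ) + 1)]
    refine mul_le_mul_of_nonneg_left ?_ (by positivity)
    refine (abs_sub _ _).trans ?_
    have a1 := abs_cos_sub_taylor_le (((j : ℝ) + 1 - δ) * t)
    have a2 := abs_cos_sub_taylor_le (δ * t)
    rw [← Even.pow_abs (by decide : Even 6), abs_mul, abs_of_nonneg ht] at a1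
    have b1 : (|(j : ℝ) + 1 - δ| * t) ^ 6 ≤ (0.625 * h * t) ^ 6 := by gcongr
    have b2 : (δ * t) ^ 6 ≤ (0.375 * h * t) ^ 6 := by gcongr
    have : 0 ≤ (h * t) ^ 6 := by positivity
    calc _ ≤ _ := add_le_add a2 a1
      _ ≤ (0.375 * h * t) ^ 6 / 720 + (0.625 * h * t) ^ 6 / 720 := by gcongr
      _ ≤ _ := by
        rw [mul_assoc (0.625 : ℝ), mul_assoc (0.375 : ℝ), mul_pow (0.625 : ℝ),
          mul_pow (0.375 : ℝ), mul_assoc (0.0625 : ℝ), ← mul_pow]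
        linarith
  have hsum := (Finset.abs_sum_le_sum_abs _ _).trans (Finset.sum_le_sum hterm)
  rw [← Finset.sum_mul, sum_succ_pow_one, ← hK] at hsum
  have hid : ∑ j ∈ Finset.range k, ((j : ℝ) + 1) *
      ((Real.cos (δ * t) - (1 - (δ * t) ^ 2 / 2 + (δ * t) ^ 4 / 24)) -
      (Real.cos (((j : ℝ) + 1 - δ) * t) - (1 - (((j : ℝ) + 1 - δ) * t) ^ 2 / 2 +
        (((j : ℝ) + 1 - δ) * t) ^ 4 / 24))) =
      steinCos k δ t - (t ^ 2 / 2 * (K ^ 2 / 4 - 2 * δ * (K * h / 3)) +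
        t ^ 4 / 24 * (-(K ^ 2 * (2 * K - 1) / 12) + 4 * δ * (K * h / 3 * ((3 * K - 1) / 5)) -
        6 * δ ^ 2 * (K ^ 2 / 4) + 4 * δ ^ 3 * (K * h / 3))) := by
    have e2 : K * h / 3 = ∑ j ∈ Finset.range k, ((j : ℝ) + 1) ^ 2 := by
      rw [sum_succ_pow_two, hK, hh]; ring
    have e3 : K ^ 2 / 4 = ∑ j ∈ Finset.range k, ((j : ℝ) + 1) ^ 3 := by
      rw [sum_succ_pow_three, hK]
    have e4 : K * h / 3 * ((3 * K - 1) / 5) = ∑ j ∈ Finset.range k, ((j : ℝ) + 1) ^ 4 := by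
      rw [sum_succ_pow_four, hK, hh]; ring
    have e5 : K ^ 2 * (2 * K - 1) / 12 = ∑ j ∈ Finset.range k, ((j : ℝ) + 1) ^ 5 := by
      rw [sum_succ_pow_five, hK]
    rw [e4, e3, e2, e5, steinCos]
    simp only [Finset.mul_sum, ← Finset.sum_sub_distrib,
      ← Finset.sum_add_distrib, ← Finset.sum_neg_distrib]
    exact Finset.sum_congr rfl fun j _ => by ring
  have hδe : δ = 3 * K / (8 * h) := by field_simp; linarith
  have hquad : K ^ 2 / 4 - 2 * δ * (K * h / 3) = 0 := by rw [hδe]; field_simp; ring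
  have hquart : -(K ^ 2 * (2 * K - 1) / 12) + 4 * δ * (K * h / 3 * ((3 * K - 1) / 5)) -
        6 * δ ^ 2 * (K ^ 2 / 4) + 4 * δ ^ 3 * (K * h / 3) =
        K ^ 2 * (2 / 15 * K - 1 / 60 - 9 / 64 * (K ^ 2 / h ^ 2)) := by
    rw [hδe]; field_simp; ring
  have hKh : K ^ 2 / h ^ 2 = K - 1 / 4 + 1 / (16 * h ^ 2) := by
    have : K = h ^ 2 - 1 / 4 := by linarith
    rw [this]; field_simp; ring
  have hinv : 1 / (16 * h ^ 2) ≤ 0.01 := by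
    rw [div_le_iff₀ (by positivity)]; nlinarith
  have hinv0 : 0 ≤ 1 / (16 * h ^ 2) := by positivity
  have hq : |2 / 15 * K - 1 / 60 - 9 / 64 * (K ^ 2 / h ^ 2)| ≤ 0.00735 * K := by
    rw [hKh, abs_le]
    constructor <;> linarith
  rw [hid, hquad, hquart, mul_zero, zero_add] at hsum
  have h1 : |t ^ 4 / 24 * (K ^ 2 * (2 / 15 * K - 1 / 60 - 9 / 64 * (K ^ 2 / h ^ 2)))| ≤
      t ^ 4 / 24 * (K ^ 2 * (0.00735 * K)) := by
    rw [abs_mul, abs_mul, abs_of_nonneg (show 0 ≤ t ^ 4 / 24 by positivity),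
      abs_of_nonneg (show 0 ≤ K ^ 2 by positivity)]
    gcongr
  have h2 := abs_add_le (steinCos k δ t -
    t ^ 4 / 24 * (K ^ 2 * (2 / 15 * K - 1 / 60 - 9 / 64 * (K ^ 2 / h ^ 2))))
    (t ^ 4 / 24 * (K ^ 2 * (2 / 15 * K - 1 / 60 - 9 / 64 * (K ^ 2 / h ^ 2))))
  rw [sub_add_cancel] at h2
  refine h2.trans ((add_le_add hsum h1).trans ?_)
  have e1 : K * h / 3 * (0.00092 * K ^ 2 / h * t ^ 4 + 0.000131 * h ^ 5 * t ^ 6) =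
      0.00092 / 3 * (K ^ 3 * t ^ 4) + 0.000131 / 3 * (K * h ^ 6 * t ^ 6) := by
    field_simp
  rw [e1]
  have p1 : 0 ≤ K ^ 3 * t ^ 4 := by positivity
  have p2 : 0 ≤ K * h ^ 6 * t ^ 6 := by positivity
  linarith

end Stein

/-- The difference of the scaled and the Stein integrands. -/
noncomputable def steinDefect (k : ℕ) (lam K h δ η t : ℝ) : ℝ :=
  K * h / 3 * (2 * Real.sin (t / 2)) * Real.sin ((δ + η) * t - phase k lam t) -
    (steinSin k δ t * Real.sin (δ * t - phase k lam t) +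
      steinCos k δ t * Real.cos (δ * t - phase k lam t))

theorem le_four_mul_sin_mul_sin_mul_cos {η t Ψ a B : ℝ} (hη0 : 0 ≤ η) (hη1 : η ≤ 1)
    (ht0 : 0 ≤ t) (ht1 : t ≤ 1) (hΨ0 : -B ≤ Ψ) (hΨ1 : Ψ ≤ a) (hB : 0 ≤ B) (ha : 0 ≤ a) :
    η * t ^ 2 * (1 - t ^ 2 / 12 - (a ^ 2 + B ^ 2) / 2) ≤
      2 * Real.sin (t / 2) * (2 * Real.sin (η * t / 2) * Real.cos Ψ) := by
  have hΨ : Ψ ^ 2 ≤ a ^ 2 + B ^ 2 := by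
    rcases le_total 0 Ψ with h | h
    · nlinarith [sq_nonneg B]
    · nlinarith [sq_nonneg a]
  have hηt : 0 ≤ η * t := by positivity
  have hηt1 : η * t ≤ t := by nlinarith
  have s1 := Real.sin_ge_sub_cube (x := t / 2) (by linarith)
  have s2 := Real.sin_ge_sub_cube (x := η * t / 2) (by linarith)
  have u1 := Real.sin_le (x := t / 2) (by linarith)
  have u2 := Real.sin_le (x := η * t / 2) (by linarith)
  have ht2 : t ^ 2 ≤ 1 := by nlinarith
  have l1 : t * (1 - t ^ 2 / 24) ≤ 2 * Real.sin (t / 2) := by linarith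
  have l2 : η * t * (1 - t ^ 2 / 24) ≤ 2 * Real.sin (η * t / 2) := by
    have : (η * t) ^ 3 ≤ η * t * t ^ 2 := by
      rw [pow_succ']
      gcongr
    linarith
  have hf : 0 ≤ 1 - t ^ 2 / 24 := by linarith
  have p1 : 0 ≤ 2 * Real.sin (t / 2) := le_trans (by positivity) l1
  have p2 : 0 ≤ 2 * Real.sin (η * t / 2) := le_trans (by positivity) l2
  have X1 : η * t ^ 2 * (1 - t ^ 2 / 12) ≤ 2 * Real.sin (t / 2) * (2 * Real.sin (η * t / 2)) := by
    have := mul_le_mul l1 l2 (by positivity) p1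
    have h4 : 0 ≤ η * t ^ 2 * (t ^ 2) ^ 2 := by positivity
    linarith
  have X2 : 2 * Real.sin (t / 2) * (2 * Real.sin (η * t / 2)) ≤ η * t ^ 2 := by
    have := mul_le_mul (show 2 * Real.sin (t / 2) ≤ t by linarith)
      (show 2 * Real.sin (η * t / 2) ≤ η * t by linarith) p2 ht0
    linarith
  have X0 : 0 ≤ 2 * Real.sin (t / 2) * (2 * Real.sin (η * t / 2)) := mul_nonneg p1 p2
  have hc := mul_le_mul_of_nonneg_left (Real.one_sub_sq_div_two_le_cos (x := Ψ)) X0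
  have hd : 2 * Real.sin (t / 2) * (2 * Real.sin (η * t / 2)) * (Ψ ^ 2 / 2) ≤
      η * t ^ 2 * ((a ^ 2 + B ^ 2) / 2) :=
    mul_le_mul X2 (by linarith) (by positivity) (by positivity)
  linarith

section Core

variable {k : ℕ} {lam K h δ η t : ℝ}

/-- Numerical consequences of `δ = 3K/(8h)` used throughout the core estimates. -/
theorem delta_bounds (hk : 2 ≤ k) (hK : K = (k : ℝ) * (k + 1)) (hh : h = (k : ℝ) + 1 / 2)
    (hδ : δ * (8 * h) = 3 * K) : 2.5 ≤ h ∧ 6 ≤ K ∧ h ^ 2 = K + 1 / 4 ∧ 1 / 2 ≤ δ ∧ δ ≤ 0.375 * h ∧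
      0 ≤ (3 * K - 1) / 30 - 1 / 24 - δ ^ 2 / 2 ∧
      (3 * K - 1) / 30 - 1 / 24 - δ ^ 2 / 2 ≤ 0.0297 * K := by
  have hk' : (2 : ℝ) ≤ k := by exact_mod_cast hk
  have hhpos : 2.5 ≤ h := by linarith
  have hh0 : 0 < h := by linarith
  have hKpos : 6 ≤ K := by rw [hK]; nlinarith
  have hh2 : h ^ 2 = K + 1 / 4 := by rw [hK, hh]; ring
  have hδ1 : δ ≤ 0.375 * h := by
    by_contra hcon
    nlinarith
  have hδ0 : 1 / 2 ≤ δ := by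
    by_contra hcon
    nlinarith
  have hδ2 : δ ^ 2 * (64 * (K + 1 / 4)) = 9 * K ^ 2 := by
    rw [← hh2]; linear_combination (δ * (8 * h) + 3 * K) * hδ
  have hδ3 : 9 / 64 * (K - 1 / 4) ≤ δ ^ 2 := by
    by_contra hcon
    nlinarith
  have hδ4 : δ ^ 2 ≤ 9 / 64 * K := by
    by_contra hcon
    nlinarith
  exact ⟨hhpos, hKpos, hh2, hδ0, hδ1, by linarith, by linarith⟩

theorem abs_steinDefect_sub_le (hk : 2 ≤ k) (hK : K = (k : ℝ) * (k + 1))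
    (hh : h = (k : ℝ) + 1 / 2) (hδ : δ * (8 * h) = 3 * K) (hlam : 0 < lam) (ht : 0 ≤ t) :
    |steinDefect k lam K h δ η t - K * h / 3 * (2 * Real.sin (t / 2) *
        (Real.sin ((δ + η) * t - phase k lam t) - Real.sin (δ * t - phase k lam t)) +
      ((3 * K - 1) / 30 - 1 / 24 - δ ^ 2 / 2) * t ^ 3 * Real.sin (δ * t - phase k lam t))| ≤
      K * h / 3 * (t ^ 2 * (0.00092 * h * (K * t ^ 2) + 0.00066 * h * (K * t ^ 2) ^ 2 +
        0.000057 * lam * h ^ 2 * (K * t ^ 2) ^ 3)) := by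
  obtain ⟨hh25, hK6, hh2, hδ0, hδ1, -, -⟩ := delta_bounds hk hK hh hδ
  have hB0 := phase_nonneg (k := k) hlam.le ht
  have hB1 := phase_le hK hlam.le ht
  have a1 := abs_sinPart_sub_le hk hK hh hδ ht
  have a2 := abs_steinCos_le hk hK hh hδ ht
  have hsin : |Real.sin (δ * t - phase k lam t)| ≤ δ * t + lam * K ^ 2 / 24 * t ^ 3 := by
    refine Real.abs_sin_le_abs.trans ?_
    rw [abs_le]
    constructor <;> linarith [show 0 ≤ δ * t by positivity]
  have hcos := Real.abs_cos_le_one (δ * t - phase k lam t)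
  have hS : 0 ≤ K * h / 3 := by positivity
  rw [steinDefect]
  obtain ⟨sΦ, hsΦ⟩ : ∃ s, s = Real.sin (δ * t - phase k lam t) := ⟨_, rfl⟩
  obtain ⟨cΦ, hcΦ⟩ : ∃ s, s = Real.cos (δ * t - phase k lam t) := ⟨_, rfl⟩
  obtain ⟨ρ, hρ⟩ : ∃ ρ, ρ = (3 * K - 1) / 30 - 1 / 24 - δ ^ 2 / 2 := ⟨_, rfl⟩
  rw [← hsΦ] at hsin ⊢
  rw [← hcΦ] at hcos ⊢
  rw [← hρ] at a1 ⊢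
  have hsplit : K * h / 3 * (2 * Real.sin (t / 2)) * Real.sin ((δ + η) * t - phase k lam t) -
      (steinSin k δ t * sΦ + steinCos k δ t * cΦ) -
      K * h / 3 * (2 * Real.sin (t / 2) * (Real.sin ((δ + η) * t - phase k lam t) - sΦ) +
        ρ * t ^ 3 * sΦ) =
      (K * h / 3 * (2 * Real.sin (t / 2)) - steinSin k δ t - K * h / 3 * ρ * t ^ 3) * sΦ -
      steinCos k δ t * cΦ := by ring
  rw [hsplit]
  refine (abs_sub _ _).trans ?_
  rw [abs_mul, abs_mul]
  have b1 := mul_le_mul a1 hsin (abs_nonneg _) (by positivity)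
  have b2 := mul_le_mul a2 hcos (abs_nonneg _) (by positivity)
  refine (add_le_add b1 b2).trans ?_
  rw [mul_one, mul_assoc, ← mul_add]
  refine mul_le_mul_of_nonneg_left ?_ hS
  have hKh : K ≤ h ^ 2 := by linarith
  have hhK : h ^ 2 ≤ 25 / 24 * K := by linarith
  have c1 : 0.00092 * K ^ 2 / h * t ^ 4 ≤ t ^ 2 * (0.00092 * h * (K * t ^ 2)) := by
    have : K ^ 2 / h ≤ h * K := by
      rw [div_le_iff₀ (by linarith)]
      nlinarith
    have := mul_le_mul_of_nonneg_right this (show 0 ≤ 0.00092 * t ^ 4 by positivity)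
    calc _ = K ^ 2 / h * (0.00092 * t ^ 4) := by ring
      _ ≤ _ := this
      _ = _ := by ring
  have hh4 : h ^ 4 ≤ 1.0851 * K ^ 2 := by
    have : h ^ 2 * h ^ 2 ≤ 25 / 24 * K * (25 / 24 * K) := by gcongr
    nlinarith
  have c2 : 0.000131 * h ^ 5 * t ^ 6 ≤ t ^ 2 * (0.000143 * h * (K * t ^ 2) ^ 2) := by
    have := mul_le_mul_of_nonneg_right hh4 (show 0 ≤ h * t ^ 6 by positivity)
    have p : 0 ≤ K ^ 2 * (h * t ^ 6) := by positivity
    linarith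
  have c3 : 0.00131 * h ^ 4 * t ^ 5 * (δ * t) ≤ t ^ 2 * (0.000513 * h * (K * t ^ 2) ^ 2) := by
    have : h ^ 4 * δ ≤ 25 / 24 * (3 / 8) * h * K ^ 2 := by
      have e : h ^ 4 * δ = h ^ 3 / 8 * (δ * (8 * h)) := by ring
      rw [e, hδ]
      have := mul_le_mul_of_nonneg_right hhK (show 0 ≤ h * (3 / 8 * K) by positivity)
      linarith
    have := mul_le_mul_of_nonneg_right this (show 0 ≤ t ^ 6 by positivity)
    have p : 0 ≤ K ^ 2 * (h * t ^ 6) := by positivity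
    linarith
  have c4 : 0.00131 * h ^ 4 * t ^ 5 * (lam * K ^ 2 / 24 * t ^ 3) ≤
      t ^ 2 * (0.000057 * lam * h ^ 2 * (K * t ^ 2) ^ 3) := by
    have := mul_le_mul_of_nonneg_right hhK (show 0 ≤ h ^ 2 * lam * K ^ 2 * t ^ 8 by positivity)
    have p : 0 ≤ h ^ 2 * lam * K ^ 3 * t ^ 8 := by positivity
    linarith
  have p : 0 ≤ t ^ 2 * (h * (K * t ^ 2) ^ 2) := by positivity
  linarith

theorem loss_le (hk : 2 ≤ k) (hK : K = (k : ℝ) * (k + 1)) (hh : h = (k : ℝ) + 1 / 2)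
    (hδ : δ * (8 * h) = 3 * K) :
    t ^ 2 / 12 + (((δ + 1 / 2) * t) ^ 2 + (lam * K ^ 2 / 24 * t ^ 3) ^ 2) / 2 ≤
      0.187 * (K * t ^ 2) + (lam * h) ^ 2 / 1152 * (K * t ^ 2) ^ 3 := by
  obtain ⟨hh25, hK6, hh2, hδ0, hδ1, -, -⟩ := delta_bounds hk hK hh hδ
  have h1 : 1 / 12 + (δ + 1 / 2) ^ 2 / 2 ≤ 0.187 * K := by nlinarith
  have h2 := mul_le_mul_of_nonneg_right h1 (sq_nonneg t)
  have h3 := mul_le_mul_of_nonneg_right (show K ≤ h ^ 2 by linarith)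
    (show 0 ≤ lam ^ 2 * K ^ 3 * t ^ 6 / 1152 by positivity)
  linarith

theorem le_steinDefect (hk : 2 ≤ k) (hK : K = (k : ℝ) * (k + 1))
    (hh : h = (k : ℝ) + 1 / 2) (hδ : δ * (8 * h) = 3 * K) (hlam : 0 < lam) (ht : 0 ≤ t)
    (hKt : K * t ^ 2 ≤ 6) (hη0 : 0 ≤ η) (hη1 : η ≤ 1) :
    K * h / 3 * (t ^ 2 * (η * (1 - 0.187 * (K * t ^ 2) - (lam * h) ^ 2 / 1152 * (K * t ^ 2) ^ 3) +
      ((3 * K - 1) / 30 - 1 / 24 - δ ^ 2 / 2) *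
        (0.375 / h * (K * t ^ 2) - (lam / 24 + 0.0089 / h) * (K * t ^ 2) ^ 2) -
      (0.00092 * h * (K * t ^ 2) + 0.00066 * h * (K * t ^ 2) ^ 2 +
        0.000057 * lam * h ^ 2 * (K * t ^ 2) ^ 3))) ≤ steinDefect k lam K h δ η t := by
  obtain ⟨hh25, hK6, hh2, hδ0, hδ1, hρ0, hρ1⟩ := delta_bounds hk hK hh hδ
  have hB0 := phase_nonneg (k := k) hlam.le ht
  have hB1 := phase_le hK hlam.le ht
  have hS : 0 ≤ K * h / 3 := by positivity
  have herr := (abs_le.mp (abs_steinDefect_sub_le (η := η) hk hK hh hδ hlam ht)).1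
  have ht1 : t ≤ 1 := by nlinarith
  have hloss := loss_le (t := t) (lam := lam) hk hK hh hδ
  have hηt : 0 ≤ η * t := by positivity
  have hηt1 : η * t ≤ t := by nlinarith
  have hmain := le_four_mul_sin_mul_sin_mul_cos (Ψ := δ * t - phase k lam t + η * t / 2)
    (a := (δ + 1 / 2) * t) (B := lam * K ^ 2 / 24 * t ^ 3) hη0 hη1 ht ht1
    (by nlinarith [show 0 ≤ δ * t by positivity]) (by linarith) (by positivity) (by positivity)
  have hdiff : Real.sin ((δ + η) * t - phase k lam t) - Real.sin (δ * t - phase k lam t) =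
      2 * Real.sin (η * t / 2) * Real.cos (δ * t - phase k lam t + η * t / 2) := by
    rw [Real.sin_sub_sin]
    congr 3 <;> ring
  rw [← hdiff] at hmain
  have hmain' : t ^ 2 * (η * (1 - 0.187 * (K * t ^ 2) -
      (lam * h) ^ 2 / 1152 * (K * t ^ 2) ^ 3)) ≤ 2 * Real.sin (t / 2) *
        (Real.sin ((δ + η) * t - phase k lam t) - Real.sin (δ * t - phase k lam t)) := by
    have := mul_le_mul_of_nonneg_left hloss (show 0 ≤ η * t ^ 2 by positivity)
    linarith
  have hsin : δ * t - lam * K ^ 2 / 24 * t ^ 3 - δ ^ 3 / 6 * t ^ 3 ≤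
      Real.sin (δ * t - phase k lam t) := by
    rcases le_total 0 (δ * t - phase k lam t) with h0 | h0
    · have := Real.sin_ge_sub_cube h0
      have h3 : (δ * t - phase k lam t) ^ 3 ≤ (δ * t) ^ 3 := by gcongr; linarith
      rw [mul_pow] at h3
      linarith
    · have := Real.sin_le (x := -(δ * t - phase k lam t)) (by linarith)
      rw [Real.sin_neg] at this
      have : 0 ≤ δ ^ 3 / 6 * t ^ 3 := by positivity
      linarith
  have hρ : t ^ 2 * (((3 * K - 1) / 30 - 1 / 24 - δ ^ 2 / 2) *
        (0.375 / h * (K * t ^ 2) - (lam / 24 + 0.0089 / h) * (K * t ^ 2) ^ 2)) ≤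
      ((3 * K - 1) / 30 - 1 / 24 - δ ^ 2 / 2) * t ^ 3 * Real.sin (δ * t - phase k lam t) := by
    rw [mul_assoc _ (t ^ 3), mul_left_comm (t ^ 2)]
    refine mul_le_mul_of_nonneg_left ?_ hρ0
    refine le_trans ?_ (mul_le_mul_of_nonneg_left hsin (by positivity))
    have e1 : δ = 0.375 / h * K := by
      field_simp; linarith
    have e2 : δ ^ 3 / 6 ≤ 0.0089 / h * K ^ 2 := by
      rw [e1]
      have : K ^ 3 / h ^ 3 ≤ K ^ 2 / h := by
        rw [div_le_div_iff₀ (by positivity) (by positivity)]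
        have := mul_le_mul_of_nonneg_right (show K ≤ h ^ 2 by linarith)
          (show 0 ≤ K ^ 2 * h by positivity)
        linarith
      have e : (0.375 / h * K) ^ 3 = 0.375 ^ 3 * (K ^ 3 / h ^ 3) := by
        rw [mul_pow, div_pow]; ring
      rw [e]
      have p : 0 ≤ K ^ 2 / h := by positivity
      have e' : 0.0089 / h * K ^ 2 = 0.0089 * (K ^ 2 / h) := by ring
      rw [e']
      linarith
    have e3 := mul_le_mul_of_nonneg_right e2 (show 0 ≤ t ^ 6 by positivity)
    have e4 : δ * t ^ 4 = 0.375 / h * K * t ^ 4 := by rw [← e1]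
    linarith
  have := mul_le_mul_of_nonneg_left (add_le_add hmain' hρ) hS
  linarith

theorem steinDefect_le (hk : 2 ≤ k) (hK : K = (k : ℝ) * (k + 1))
    (hh : h = (k : ℝ) + 1 / 2) (hδ : δ * (8 * h) = 3 * K) (hlam : 0 < lam) (ht : 0 ≤ t)
    (hKt : K * t ^ 2 ≤ 6) (hη0 : 0 ≤ η) (hη1 : η ≤ 1) :
    K * h / 3 * (t ^ 2 * (η * (1 - 0.187 * (K * t ^ 2) - (lam * h) ^ 2 / 1152 * (K * t ^ 2) ^ 3) -
      ((3 * K - 1) / 30 - 1 / 24 - δ ^ 2 / 2) * (1.32 / (lam * h ^ 2)) +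
      ((3 * K - 1) / 30 - 1 / 24 - δ ^ 2 / 2) / 4 *
        (0.375 / h * (K * t ^ 2) - lam / 24 * (K * t ^ 2) ^ 2) -
      (0.00092 * h * (K * t ^ 2) + 0.00066 * h * (K * t ^ 2) ^ 2 +
        0.000057 * lam * h ^ 2 * (K * t ^ 2) ^ 3))) ≤ -steinDefect k lam K h δ (-η) t := by
  obtain ⟨hh25, hK6, hh2, hδ0, hδ1, hρ0, hρ1⟩ := delta_bounds hk hK hh hδ
  have hB0 := phase_nonneg (k := k) hlam.le ht
  have hB1 := phase_le hK hlam.le ht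
  have hB2 := le_phase hK hlam.le ht hKt
  have hS : 0 ≤ K * h / 3 := by positivity
  have herr := (abs_le.mp (abs_steinDefect_sub_le (η := -η) hk hK hh hδ hlam ht)).2
  have ht1 : t ≤ 1 := by nlinarith
  have hloss := loss_le (t := t) (lam := lam) hk hK hh hδ
  have hηt : 0 ≤ η * t := by positivity
  have hηt1 : η * t ≤ t := by nlinarith
  have hδt : 1 / 2 * t ≤ δ * t := by gcongr
  have hmain := le_four_mul_sin_mul_sin_mul_cos (Ψ := δ * t - phase k lam t - η * t / 2)
    (a := (δ + 1 / 2) * t) (B := lam * K ^ 2 / 24 * t ^ 3) hη0 hη1 ht ht1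
    (by linarith) (by linarith) (by positivity) (by positivity)
  have hdiff : Real.sin (δ * t - phase k lam t) - Real.sin ((δ + -η) * t - phase k lam t) =
      2 * Real.sin (η * t / 2) * Real.cos (δ * t - phase k lam t - η * t / 2) := by
    rw [Real.sin_sub_sin]
    congr 3 <;> ring
  rw [← hdiff] at hmain
  have hmain' : t ^ 2 * (η * (1 - 0.187 * (K * t ^ 2) -
      (lam * h) ^ 2 / 1152 * (K * t ^ 2) ^ 3)) ≤ 2 * Real.sin (t / 2) *
        (Real.sin (δ * t - phase k lam t) - Real.sin ((δ + -η) * t - phase k lam t)) := by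
    have := mul_le_mul_of_nonneg_left hloss (show 0 ≤ η * t ^ 2 by positivity)
    linarith
  have e1 : δ = 0.375 / h * K := by
    field_simp; linarith
  have hpos : t ^ 3 * (δ * t - phase k lam t) ≤ t ^ 2 * (1.056 / (lam * h ^ 2)) := by
    have h1 : t ^ 3 * (δ * t - phase k lam t) ≤
        t ^ 2 * (δ * t ^ 2 - 0.8 * (lam * K ^ 2 / 24) * (t ^ 2) ^ 2) := by
      have := mul_le_mul_of_nonneg_left hB2 (show 0 ≤ t ^ 3 by positivity)
      linarith
    refine h1.trans (mul_le_mul_of_nonneg_left ?_ (sq_nonneg t))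
    rw [e1]
    have h3 : 1.056 / (lam * h ^ 2) - (0.375 / h * K * t ^ 2 -
        0.8 * (lam * K ^ 2 / 24) * (t ^ 2) ^ 2) =
        lam / 30 * (K * t ^ 2 - 5.625 / (lam * h)) ^ 2 + 0.0013125 / (lam * h ^ 2) := by
      field_simp; ring
    have h4 : 0 ≤ lam / 30 * (K * t ^ 2 - 5.625 / (lam * h)) ^ 2 + 0.0013125 / (lam * h ^ 2) := by
      positivity
    linarith
  have hsin : t ^ 3 * Real.sin (δ * t - phase k lam t) ≤
      t ^ 2 * (1.32 / (lam * h ^ 2)) - t ^ 3 * (δ * t - phase k lam t) / 4 := by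
    have e : (1.32 : ℝ) / (lam * h ^ 2) = 1.25 * (1.056 / (lam * h ^ 2)) := by ring
    rcases le_total 0 (δ * t - phase k lam t) with h0 | h0
    · have := mul_le_mul_of_nonneg_left (Real.sin_le h0) (show 0 ≤ t ^ 3 by positivity)
      rw [e]
      linarith
    · have := neg_sin_le_div_four (x := -(δ * t - phase k lam t)) (by linarith)
      rw [Real.sin_neg] at this
      have := mul_le_mul_of_nonneg_left this (show 0 ≤ t ^ 3 by positivity)
      have : 0 ≤ t ^ 2 * (1.32 / (lam * h ^ 2)) := by positivity
      linarith
  have hρ : t ^ 2 * (((3 * K - 1) / 30 - 1 / 24 - δ ^ 2 / 2) / 4 *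
        (0.375 / h * (K * t ^ 2) - lam / 24 * (K * t ^ 2) ^ 2) -
        ((3 * K - 1) / 30 - 1 / 24 - δ ^ 2 / 2) * (1.32 / (lam * h ^ 2))) ≤
      -(((3 * K - 1) / 30 - 1 / 24 - δ ^ 2 / 2) * t ^ 3 *
        Real.sin (δ * t - phase k lam t)) := by
    have h1 : t ^ 3 * Real.sin (δ * t - phase k lam t) ≤ t ^ 2 * (1.32 / (lam * h ^ 2)) -
        t ^ 2 * (0.375 / h * (K * t ^ 2) - lam / 24 * (K * t ^ 2) ^ 2) / 4 := by
      have h2 := mul_le_mul_of_nonneg_left hB1 (show 0 ≤ t ^ 3 by positivity)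
      have e4 : δ * t ^ 4 = 0.375 / h * K * t ^ 4 := by rw [← e1]
      linarith
    have := mul_le_mul_of_nonneg_left h1 hρ0
    linarith
  have := mul_le_mul_of_nonneg_left (add_le_add hmain' hρ) hS
  linarith

end Core

/-- Moments of the damped weight on the core interval. -/
noncomputable def coreMoment (k : ℕ) (lam K t₀ : ℝ) (i : ℕ) : ℝ :=
  ∫ t in (0 : ℝ)..t₀, Real.exp (-damping k lam t) * (t ^ 2 * (K * t ^ 2) ^ i)

section Moments

variable {k : ℕ} {lam K h t₀ : ℝ}

theorem coreMoment_pos (hK : 0 < K) (ht₀ : 0 < t₀) (i : ℕ) : 0 < coreMoment k lam K t₀ i := by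
  refine intervalIntegral.intervalIntegral_pos_of_pos_on
    (Continuous.intervalIntegrable (by fun_prop) _ _) (fun t ht => ?_) ht₀
  have := ht.1
  positivity

theorem coreMoment_succ_le (hK : 0 < K) (ht₀ : 0 < t₀) (hKt : K * t₀ ^ 2 = 6) (i : ℕ) :
    coreMoment k lam K t₀ (i + 1) ≤ 6 * coreMoment k lam K t₀ i := by
  unfold coreMoment
  rw [← intervalIntegral.integral_const_mul]
  refine intervalIntegral.integral_mono_on ht₀.le
    (Continuous.intervalIntegrable (by fun_prop) _ _)
    (Continuous.intervalIntegrable (by fun_prop) _ _) fun t ht => ?_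
  have h1 : K * t ^ 2 ≤ 6 := by
    rw [← hKt]
    have := ht.1
    have := ht.2
    gcongr
  have h2 : 0 ≤ Real.exp (-damping k lam t) * (t ^ 2 * (K * t ^ 2) ^ i) := by positivity
  calc _ = (K * t ^ 2) * (Real.exp (-damping k lam t) * (t ^ 2 * (K * t ^ 2) ^ i)) := by ring
    _ ≤ _ := mul_le_mul_of_nonneg_right h1 h2

theorem coreMoment_recurrence_le (hK : K = (k : ℝ) * (k + 1)) (hh : h = (k : ℝ) + 1 / 2)
    (hlam : 0 ≤ lam) (ht₀ : 0 < t₀) (i : ℕ) :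
    lam * h / 3 * (coreMoment k lam K t₀ (i + 1) - coreMoment k lam K t₀ (i + 2) / 10) ≤
      (2 * i + 3) * coreMoment k lam K t₀ i := by
  have hK0 : 0 ≤ K := by rw [hK]; positivity
  have hder : ∀ t : ℝ, HasDerivAt
      (fun t => Real.exp (-damping k lam t) * (K ^ i * t ^ (2 * i + 3)))
      (Real.exp (-damping k lam t) * -(lam * ∑ j ∈ Finset.range k, ((j : ℝ) + 1) *
        Real.sin (((j : ℝ) + 1) * t)) * (K ^ i * t ^ (2 * i + 3)) +
        Real.exp (-damping k lam t) * (K ^ i * ((2 * i + 3) * t ^ (2 * i + 2)))) t := by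
    intro t
    have h1 := (hasDerivAt_damping k lam t).neg.exp
    have h2 := ((hasDerivAt_pow (2 * i + 3) t).const_mul (K ^ i))
    refine (h1.mul h2).congr_deriv ?_
    push_cast
    simp
  have hint := intervalIntegral.integral_eq_sub_of_hasDerivAt (a := 0) (b := t₀)
    (fun t _ => hder t) (Continuous.intervalIntegrable (by fun_prop) _ _)
  have hge : 0 ≤ ∫ t in (0 : ℝ)..t₀,
      (Real.exp (-damping k lam t) * -(lam * ∑ j ∈ Finset.range k, ((j : ℝ) + 1) *
        Real.sin (((j : ℝ) + 1) * t)) * (K ^ i * t ^ (2 * i + 3)) +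
        Real.exp (-damping k lam t) * (K ^ i * ((2 * i + 3) * t ^ (2 * i + 2)))) := by
    rw [hint]
    have : (0 : ℝ) ^ (2 * i + 3) = 0 := zero_pow (by omega)
    rw [this]
    simp only [mul_zero, sub_zero]
    positivity
  have hle : (∫ t in (0 : ℝ)..t₀,
      (Real.exp (-damping k lam t) * -(lam * ∑ j ∈ Finset.range k, ((j : ℝ) + 1) *
        Real.sin (((j : ℝ) + 1) * t)) * (K ^ i * t ^ (2 * i + 3)) +
        Real.exp (-damping k lam t) * (K ^ i * ((2 * i + 3) * t ^ (2 * i + 2))))) ≤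
      ∫ t in (0 : ℝ)..t₀, ((2 * i + 3) * (Real.exp (-damping k lam t) *
        (t ^ 2 * (K * t ^ 2) ^ i)) - lam * h / 3 * (Real.exp (-damping k lam t) *
        (t ^ 2 * (K * t ^ 2) ^ (i + 1)) - Real.exp (-damping k lam t) *
        (t ^ 2 * (K * t ^ 2) ^ (i + 2)) / 10)) := by
    refine intervalIntegral.integral_mono_on ht₀.le
      (Continuous.intervalIntegrable (by fun_prop) _ _)
      (Continuous.intervalIntegrable (by fun_prop) _ _) fun t ht => ?_
    have h1 := mul_le_mul_of_nonneg_left (le_deriv_damping hK hh hlam ht.1)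
      (show 0 ≤ Real.exp (-damping k lam t) * (K ^ i * t ^ (2 * i + 3)) by
        have := ht.1
        positivity)
    have e1 : K ^ i * t ^ (2 * i + 2) = t ^ 2 * (K * t ^ 2) ^ i := by
      rw [mul_pow, ← pow_mul]; ring
    have e2 : K ^ i * t ^ (2 * i + 3) * (t * K) = t ^ 2 * (K * t ^ 2) ^ (i + 1) := by
      rw [mul_pow, ← pow_mul]; ring
    have e3 : K ^ i * t ^ (2 * i + 3) * (t * K) * (K * t ^ 2) =
        t ^ 2 * (K * t ^ 2) ^ (i + 2) := by
      rw [e2]; ring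
    rw [← e1, ← e2, ← e3]
    linarith
  have hM : ∀ j, IntervalIntegrable (fun t => Real.exp (-damping k lam t) *
      (t ^ 2 * (K * t ^ 2) ^ j)) MeasureTheory.volume 0 t₀ := fun j =>
    Continuous.intervalIntegrable (by fun_prop) _ _
  rw [intervalIntegral.integral_sub ((hM i).const_mul _)
    (((hM (i + 1)).sub ((hM (i + 2)).div_const _)).const_mul _),
    intervalIntegral.integral_const_mul, intervalIntegral.integral_const_mul,
    intervalIntegral.integral_sub (hM _) ((hM _).div_const _),
    intervalIntegral.integral_div] at hle
  unfold coreMoment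
  linarith

theorem coreMoment_ratios (hk : 2 ≤ k) (hK : K = (k : ℝ) * (k + 1)) (hh : h = (k : ℝ) + 1 / 2)
    (hT : 48 ≤ lam * h) (ht₀ : 0 < t₀) (hKt : K * t₀ ^ 2 = 6) :
    lam * h * coreMoment k lam K t₀ 1 ≤ 9.31 * coreMoment k lam K t₀ 0 ∧
    lam * h * coreMoment k lam K t₀ 2 ≤ 15.81 * coreMoment k lam K t₀ 1 ∧
    lam * h * coreMoment k lam K t₀ 3 ≤ 24.44 * coreMoment k lam K t₀ 2 := by
  have hK0 : 0 < K := by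
    have : (2 : ℝ) ≤ k := by exact_mod_cast hk
    rw [hK]; positivity
  have hh0 : 0 < h := by rw [hh]; positivity
  have hlam : 0 < lam := by
    by_contra hcon
    nlinarith
  have r0 := coreMoment_recurrence_le hK hh hlam.le ht₀ 0
  have r1 := coreMoment_recurrence_le hK hh hlam.le ht₀ 1
  have r2 := coreMoment_recurrence_le hK hh hlam.le ht₀ 2
  have r3 := coreMoment_recurrence_le hK hh hlam.le ht₀ 3
  have s4 := coreMoment_succ_le (k := k) (lam := lam) hK0 ht₀ hKt 4
  have p0 := coreMoment_pos (k := k) (lam := lam) hK0 ht₀ 0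
  have p1 := coreMoment_pos (k := k) (lam := lam) hK0 ht₀ 1
  have p2 := coreMoment_pos (k := k) (lam := lam) hK0 ht₀ 2
  have p3 := coreMoment_pos (k := k) (lam := lam) hK0 ht₀ 3
  norm_num at r0 r1 r2 r3 s4
  generalize coreMoment k lam K t₀ 0 = M0 at *
  generalize coreMoment k lam K t₀ 1 = M1 at *
  generalize coreMoment k lam K t₀ 2 = M2 at *
  generalize coreMoment k lam K t₀ 3 = M3 at *
  generalize coreMoment k lam K t₀ 4 = M4 at *
  generalize coreMoment k lam K t₀ 5 = M5 at *
  generalize lam * h = T at *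
  have c4 : T * M4 ≤ 67.5 * M3 := by nlinarith
  have c4' : M4 ≤ 1.40625 * M3 := by nlinarith
  have c3 : T * M3 ≤ 24.44 * M2 := by nlinarith
  have c3' : M3 ≤ 0.5092 * M2 := by nlinarith
  have c2 : T * M2 ≤ 15.81 * M1 := by nlinarith
  have c2' : M2 ≤ 0.3294 * M1 := by nlinarith
  exact ⟨by nlinarith, c2, c3⟩

theorem le_coreMoment_zero (hk : 2 ≤ k) (hK : K = (k : ℝ) * (k + 1))
    (hh : h = (k : ℝ) + 1 / 2) (hlam : 2 ≤ lam) (hT : 48 ≤ lam * h) (ht₀ : 0 < t₀)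
    (hKt : K * t₀ ^ 2 = 6) : 2000 / (lam * h) ^ 6 ≤ coreMoment k lam K t₀ 0 := by
  have hk' : (2 : ℝ) ≤ k := by exact_mod_cast hk
  have hKh : K = h ^ 2 - 1 / 4 := by rw [hK, hh]; ring
  have hh2 : 2.5 ≤ h := by linarith
  have hhT : 2 * h ≤ lam * h := by nlinarith
  set T := lam * h with hTdef
  have hT0 : 0 < T := by linarith
  set s := 20 / T ^ 2 with hs
  have hs0 : 0 < s := by positivity
  have hKT : 4 * K ≤ T ^ 2 := by nlinarith
  have hst : s ≤ t₀ := by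
    have h1 : K * s ^ 2 ≤ 6 := by
      have : K * s ^ 2 = 400 * K / (T ^ 2 * T ^ 2) := by rw [hs]; field_simp; ring
      rw [this, div_le_iff₀ (by positivity)]
      have h2 : 2304 ≤ T ^ 2 := by nlinarith
      have h3 := mul_le_mul_of_nonneg_right h2 (sq_nonneg T)
      linarith
    by_contra hcon
    push Not at hcon
    have hK0 : 0 < K := by rw [hK]; positivity
    have : t₀ ^ 2 < s ^ 2 := by gcongr
    nlinarith
  have hmono : (∫ t in (0 : ℝ)..s, Real.exp (-damping k lam t) * (t ^ 2 * (K * t ^ 2) ^ 0)) ≤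
      coreMoment k lam K t₀ 0 := by
    unfold coreMoment
    refine intervalIntegral.integral_mono_interval le_rfl hs0.le hst ?_
      (Continuous.intervalIntegrable (by fun_prop) _ _)
    refine Filter.Eventually.of_forall fun t => ?_
    simp only [pow_zero, Pi.zero_apply]
    positivity
  have hlow : (∫ t in (0 : ℝ)..s, (t ^ 2 - T * K / 6 * t ^ 4)) ≤
      ∫ t in (0 : ℝ)..s, Real.exp (-damping k lam t) * (t ^ 2 * (K * t ^ 2) ^ 0) := by
    refine intervalIntegral.integral_mono_on hs0.le
      (Continuous.intervalIntegrable (by fun_prop) _ _)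
      (Continuous.intervalIntegrable (by fun_prop) _ _) fun t ht => ?_
    have h1 := Real.add_one_le_exp (-damping k lam t)
    have h2 := damping_le (t := t) hK hh (by linarith : 0 ≤ lam)
    have h3 : 1 - T * K / 6 * t ^ 2 ≤ Real.exp (-damping k lam t) := by
      rw [hTdef]; linarith
    have := mul_le_mul_of_nonneg_right h3 (sq_nonneg t)
    rw [pow_zero, mul_one]
    linarith
  refine le_trans ?_ (hlow.trans hmono)
  have hval : (∫ t in (0 : ℝ)..s, (t ^ 2 - T * K / 6 * t ^ 4)) =
      s ^ 3 / 3 - T * K / 6 * (s ^ 5 / 5) := by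
    rw [intervalIntegral.integral_sub (Continuous.intervalIntegrable (by fun_prop) _ _)
      (Continuous.intervalIntegrable (by fun_prop) _ _), intervalIntegral.integral_const_mul,
      integral_pow, integral_pow]
    norm_num
  rw [hval]
  have h1 : T * K / 6 * (s ^ 5 / 5) ≤ T * (T ^ 2 / 4) / 6 * (s ^ 5 / 5) := by
    have : K ≤ T ^ 2 / 4 := by linarith
    gcongr
  have h2 : T * (T ^ 2 / 4) / 6 * (s ^ 5 / 5) = 80000 / 3 / T ^ 7 := by
    rw [hs]; field_simp; ring
  have h3 : s ^ 3 / 3 = 8000 / 3 / T ^ 6 := by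
    rw [hs]; field_simp; ring
  have h4 : 80000 / 3 / T ^ 7 ≤ 80000 / 3 / 48 / T ^ 6 := by
    rw [div_div _ _ (T ^ 6)]
    have : 48 * T ^ 6 ≤ T ^ 7 := by
      have : T ^ 7 = T * T ^ 6 := by ring
      rw [this]; gcongr
    gcongr
  have h5 : 8000 / 3 / T ^ 6 - 80000 / 3 / 48 / T ^ 6 - 2000 / T ^ 6 = (1000 / 9) / T ^ 6 := by
    ring
  have h6 : 0 < (1000 / 9) / T ^ 6 := by positivity
  linarith

end Moments

@[fun_prop]
theorem continuous_steinDefect (k : ℕ) (lam K h δ η : ℝ) :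
    Continuous (steinDefect k lam K h δ η) := by
  unfold steinDefect; fun_prop

section Combine

variable {k : ℕ} {lam K h δ η t₀ : ℝ}

theorem abs_steinDefect_le (hK : K = (k : ℝ) * (k + 1)) (hh : h = (k : ℝ) + 1 / 2) (t : ℝ) :
    |steinDefect k lam K h δ η t| ≤ 2 * (K * h / 3) + K := by
  have hS : 0 ≤ K * h / 3 := by rw [hK, hh]; positivity
  have h1 : |K * h / 3 * (2 * Real.sin (t / 2)) * Real.sin ((δ + η) * t - phase k lam t)| ≤
      2 * (K * h / 3) := by
    rw [abs_mul, abs_mul, abs_mul, abs_of_nonneg hS, abs_two]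
    have a1 := Real.abs_sin_le_one (t / 2)
    have a2 := Real.abs_sin_le_one ((δ + η) * t - phase k lam t)
    calc _ ≤ K * h / 3 * (2 * 1) * 1 := by gcongr
      _ = _ := by ring
  have h2 : |steinSin k δ t * Real.sin (δ * t - phase k lam t) +
      steinCos k δ t * Real.cos (δ * t - phase k lam t)| ≤ K := by
    have e : steinSin k δ t * Real.sin (δ * t - phase k lam t) +
        steinCos k δ t * Real.cos (δ * t - phase k lam t) =
        ∑ j ∈ Finset.range k, ((j : ℝ) + 1) * (Real.cos (δ * t - phase k lam t - δ * t) -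
          Real.cos (δ * t - phase k lam t + ((j : ℝ) + 1 - δ) * t)) := by
      unfold steinSin steinCos
      rw [Finset.sum_mul, Finset.sum_mul, ← Finset.sum_add_distrib]
      refine Finset.sum_congr rfl fun j _ => ?_
      rw [Real.cos_sub (δ * t - phase k lam t), Real.cos_add]
      ring
    rw [e]
    refine (Finset.abs_sum_le_sum_abs _ _).trans ?_
    have : K = ∑ j ∈ Finset.range k, ((j : ℝ) + 1) * 2 := by
      rw [← Finset.sum_mul]
      rw [sum_succ_pow_one, hK]; ring
    rw [this]
    refine Finset.sum_le_sum fun j _ => ?_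
    rw [abs_mul, abs_of_nonneg (by positivity : 0 ≤ (j : ℝ) + 1)]
    refine mul_le_mul_of_nonneg_left ?_ (by positivity)
    refine (abs_sub _ _).trans ?_
    have a1 := Real.abs_cos_le_one (δ * t - phase k lam t - δ * t)
    have a2 := Real.abs_cos_le_one (δ * t - phase k lam t + ((j : ℝ) + 1 - δ) * t)
    linarith
  unfold steinDefect
  exact (abs_sub _ _).trans (add_le_add h1 h2)

theorem exp_neg_le_inv_pow_six {T : ℝ} (hT : 48 ≤ T) :
    Real.exp (-(0.58 * T)) ≤ (1 / 7.5) / T ^ 6 := by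
  have h4 : 54.5 ≤ Real.exp 4 := by
    have h1 := Real.exp_one_gt_d9
    have : Real.exp 4 = Real.exp 1 ^ 4 := by rw [← Real.exp_nat_mul]; norm_num
    rw [this]
    calc (54.5 : ℝ) ≤ 2.718 ^ 4 := by norm_num
      _ ≤ _ := by gcongr; linarith
  have ha : 1.4 * T ≤ Real.exp (0.58 * T / 6) := by
    have h1 := Real.add_one_le_exp (0.58 * T / 6 - 4)
    have h2 : Real.exp (0.58 * T / 6) = Real.exp 4 * Real.exp (0.58 * T / 6 - 4) := by
      rw [← Real.exp_add]; congr 1; ring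
    rw [h2]
    calc 1.4 * T ≤ 54.5 * (0.58 * T / 6 - 4 + 1) := by linarith
      _ ≤ _ := mul_le_mul h4 h1 (by linarith) (by positivity)
  have h6 : (1.4 * T) ^ 6 ≤ Real.exp (0.58 * T) := by
    have : Real.exp (0.58 * T) = Real.exp (0.58 * T / 6) ^ 6 := by
      rw [← Real.exp_nat_mul]; congr 1; push_cast; ring
    rw [this]; gcongr
  have hT6 : 0 < T ^ 6 := by positivity
  have h7 : 7.5 * T ^ 6 ≤ Real.exp (0.58 * T) := by
    refine le_trans ?_ h6
    rw [mul_pow]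
    gcongr
    norm_num
  rw [Real.exp_neg, div_div, ← one_div]
  exact one_div_le_one_div_of_le (by positivity) h7

theorem abs_tail_le (hk : 2 ≤ k) (hK : K = (k : ℝ) * (k + 1)) (hh : h = (k : ℝ) + 1 / 2)
    (hlam : 2 ≤ lam) (hT : 48 ≤ lam * h) (ht₀ : 0 < t₀) (hKt : K * t₀ ^ 2 = 6)
    (htpi : t₀ ≤ Real.pi) :
    |∫ t in t₀..Real.pi, Real.exp (-damping k lam t) * steinDefect k lam K h δ η t| ≤
      K * h / 3 * (0.001 * coreMoment k lam K t₀ 0) := by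
  have hk' : (2 : ℝ) ≤ k := by exact_mod_cast hk
  have hK0 : 0 < K := by rw [hK]; positivity
  have hh2 : 2.5 ≤ h := by linarith
  have hT0 : 0 < lam * h := by linarith
  have hKS : K ≤ 1.2 * (K * h / 3) := by nlinarith
  have hb : ∀ t ∈ Set.uIoc t₀ Real.pi,
      ‖Real.exp (-damping k lam t) * steinDefect k lam K h δ η t‖ ≤
        (1 / 7.5) / (lam * h) ^ 6 * (3.2 * (K * h / 3)) := by
    intro t ht
    rw [Set.uIoc_of_le htpi] at ht
    rw [Real.norm_eq_abs, abs_mul, Real.abs_exp]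
    have h1 := le_damping_of_le (lam := lam) hk hK hh (by linarith) ht₀ hKt ht.1.le ht.2
    have h2 : Real.exp (-damping k lam t) ≤ (1 / 7.5) / (lam * h) ^ 6 :=
      le_trans (Real.exp_le_exp.mpr (by linarith)) (exp_neg_le_inv_pow_six hT)
    have h3 := abs_steinDefect_le (lam := lam) (δ := δ) (η := η) hK hh t
    exact mul_le_mul h2 (by linarith) (abs_nonneg _) (by positivity)
  have h1 := intervalIntegral.norm_integral_le_of_norm_le_const hb
  rw [Real.norm_eq_abs, abs_of_nonneg (by linarith : 0 ≤ Real.pi - t₀)] at h1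
  refine h1.trans ?_
  have h2 := le_coreMoment_zero hk hK hh hlam hT ht₀ hKt
  have h3 : Real.pi - t₀ ≤ 4 := by linarith [Real.pi_le_four]
  have hS : 0 < K * h / 3 := by positivity
  calc _ ≤ (1 / 7.5) / (lam * h) ^ 6 * (3.2 * (K * h / 3)) * 4 := by gcongr
    _ = K * h / 3 * (12.8 / 7.5 / (lam * h) ^ 6) := by ring
    _ ≤ K * h / 3 * (0.001 * (2000 / (lam * h) ^ 6)) := by
      gcongr
      rw [← mul_div_assoc]
      gcongr
      norm_num
    _ ≤ _ := by gcongr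

/-- The scalar budget that makes the core contribution dominate. -/
theorem core_budget {ρ M₀ M₁ M₂ M₃ : ℝ} (hlam : 2 ≤ lam) (hh : 2.5 ≤ h) (hT : 48 ≤ lam * h)
    (hρ0 : 0 ≤ ρ) (hρ : ρ ≤ 0.0297 * h ^ 2) (p₁ : 0 < M₁) (p₂ : 0 < M₂)
    (r₁ : lam * h * M₁ ≤ 9.31 * M₀) (r₂ : lam * h * M₂ ≤ 15.81 * M₁)
    (r₃ : lam * h * M₃ ≤ 24.44 * M₂) :
    0.898 * M₀ ≤ M₀ - 0.187 * M₁ - (lam * h) ^ 2 / 1152 * M₃ ∧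
    -(0.04 * M₀) ≤ ρ * (0.375 / h * M₁ - (lam / 24 + 0.0089 / h) * M₂) ∧
    ρ * (1.32 / (lam * h ^ 2)) ≤ 0.0197 ∧
    0.00092 * h * M₁ + 0.00066 * h * M₂ + 0.000057 * lam * h ^ 2 * M₃ ≤ 0.0075 * M₀ := by
  have hh0 : 0 < h := by linarith
  obtain ⟨q, rfl⟩ : ∃ q, ρ = q * h := ⟨ρ / h, by field_simp⟩
  have hq0 : 0 ≤ q := nonneg_of_mul_nonneg_left hρ0 hh0
  have hq : q ≤ 0.0297 * h := by
    by_contra hcon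
    nlinarith
  have hTh : 2 * h ≤ lam * h := by nlinarith
  have e1 : q * h * (0.375 / h * M₁ - (lam / 24 + 0.0089 / h) * M₂) =
      q * (0.375 * M₁ - (lam * h / 24 + 0.0089) * M₂) := by field_simp
  have e2 : q * h * (1.32 / (lam * h ^ 2)) = 1.32 * q / (lam * h) := by field_simp
  have e3 : 0.000057 * lam * h ^ 2 * M₃ = 0.000057 * h * (lam * h * M₃) := by ring
  rw [e1, e2, e3]
  generalize lam * h = T at *
  have hT0 : 0 < T := by linarith
  have m1 : 48 * M₁ ≤ 9.31 * M₀ := by nlinarith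
  have hm1 : 2 * (h * M₁) ≤ 9.31 * M₀ := by nlinarith
  have m2 : 48 * M₂ ≤ 15.81 * M₁ := by nlinarith
  have hm2 : 2 * (h * M₂) ≤ 15.81 * M₁ := by nlinarith
  have tt3 : T ^ 2 * M₃ ≤ 24.44 * 15.81 * M₁ := by nlinarith
  have hm3 : h * (T * M₃) ≤ 24.44 * (h * M₂) := by nlinarith
  refine ⟨by linarith, ?_, ?_, by linarith⟩
  · have a1 : -(0.2867 * M₁) ≤ 0.375 * M₁ - (T / 24 + 0.0089) * M₂ := by linarith
    have a2 := mul_le_mul_of_nonneg_left a1 hq0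
    have a3 : q * M₁ ≤ 0.0297 * h * M₁ := by gcongr
    linarith
  · rw [div_le_iff₀ hT0]
    linarith

theorem exists_core_radius (hk : 2 ≤ k) (hK : K = (k : ℝ) * (k + 1)) :
    ∃ t₀ : ℝ, 0 < t₀ ∧ K * t₀ ^ 2 = 6 ∧ t₀ ≤ Real.pi := by
  have hk' : (2 : ℝ) ≤ k := by exact_mod_cast hk
  have hK6 : 6 ≤ K := by rw [hK]; nlinarith
  refine ⟨Real.sqrt (6 / K), by positivity, ?_, ?_⟩
  · rw [Real.sq_sqrt (by positivity)]; field_simp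
  · have : Real.sqrt (6 / K) ≤ 1 := by
      rw [Real.sqrt_le_left zero_le_one, one_pow, div_le_one (by positivity)]
      exact hK6
    linarith [Real.pi_gt_three]

theorem integral_core_eq (c₀ c₁ c₂ c₃ S : ℝ) :
    (∫ t in (0 : ℝ)..t₀, Real.exp (-damping k lam t) *
      (S * (t ^ 2 * (c₀ + c₁ * (K * t ^ 2) + c₂ * (K * t ^ 2) ^ 2 + c₃ * (K * t ^ 2) ^ 3)))) =
    S * (c₀ * coreMoment k lam K t₀ 0 + c₁ * coreMoment k lam K t₀ 1 +
      c₂ * coreMoment k lam K t₀ 2 + c₃ * coreMoment k lam K t₀ 3) := by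
  have hM : ∀ j, IntervalIntegrable (fun t => Real.exp (-damping k lam t) *
      (t ^ 2 * (K * t ^ 2) ^ j)) MeasureTheory.volume 0 t₀ := fun j =>
    Continuous.intervalIntegrable (by fun_prop) _ _
  unfold coreMoment
  rw [← intervalIntegral.integral_const_mul, ← intervalIntegral.integral_const_mul,
    ← intervalIntegral.integral_const_mul, ← intervalIntegral.integral_const_mul,
    ← intervalIntegral.integral_add ((hM 0).const_mul _) ((hM 1).const_mul _),
    ← intervalIntegral.integral_add (((hM 0).const_mul _).add ((hM 1).const_mul _))
      ((hM 2).const_mul _),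
    ← intervalIntegral.integral_add ((((hM 0).const_mul _).add ((hM 1).const_mul _)).add
      ((hM 2).const_mul _)) ((hM 3).const_mul _), ← intervalIntegral.integral_const_mul]
  refine intervalIntegral.integral_congr fun t _ => ?_
  simp only [pow_zero, pow_one]
  ring

theorem integral_steinDefect_pos (hk : 2 ≤ k) (hK : K = (k : ℝ) * (k + 1))
    (hh : h = (k : ℝ) + 1 / 2) (hδ : δ * (8 * h) = 3 * K) (hlam : 2 ≤ lam)
    (hT : 48 ≤ lam * h) (hη0 : 1 / 16 ≤ η) (hη1 : η ≤ 1) :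
    0 < ∫ t in (0 : ℝ)..Real.pi, Real.exp (-damping k lam t) * steinDefect k lam K h δ η t := by
  obtain ⟨t₀, ht₀, hKt, htpi⟩ := exists_core_radius hk hK
  obtain ⟨hh2, hK6, hhK, -, -, hρ0, hρ⟩ := delta_bounds hk hK hh hδ
  have hint : ∀ a b, IntervalIntegrable (fun t => Real.exp (-damping k lam t) *
      steinDefect k lam K h δ η t) MeasureTheory.volume a b := fun a b =>
    Continuous.intervalIntegrable (by fun_prop) _ _
  rw [← intervalIntegral.integral_add_adjacent_intervals (hint 0 t₀) (hint t₀ Real.pi)]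
  have htail := (abs_le.mp (abs_tail_le (δ := δ) (η := η) hk hK hh hlam hT ht₀ hKt htpi)).1
  obtain ⟨r₁, r₂, r₃⟩ := coreMoment_ratios hk hK hh hT ht₀ hKt
  have hK0 : 0 < K := by linarith
  have p := coreMoment_pos (k := k) (lam := lam) hK0 ht₀
  have hcore := intervalIntegral.integral_mono_on (μ := MeasureTheory.volume) ht₀.le
    (Continuous.intervalIntegrable (by fun_prop) _ _) (hint 0 t₀) fun t ht =>
      mul_le_mul_of_nonneg_left (le_steinDefect hk hK hh hδ (by linarith : 0 < lam) ht.1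
        (by rw [← hKt]; have := ht.1; have := ht.2; gcongr) (by linarith : 0 ≤ η) hη1)
        (Real.exp_nonneg (-damping k lam t))
  set ρ := (3 * K - 1) / 30 - 1 / 24 - δ ^ 2 / 2
  have e := integral_core_eq (k := k) (lam := lam) (K := K) (t₀ := t₀) η
    (-(0.187 * η) + ρ * (0.375 / h) - 0.00092 * h) (-(ρ * (lam / 24 + 0.0089 / h)) - 0.00066 * h)
    (-(η * ((lam * h) ^ 2 / 1152)) - 0.000057 * lam * h ^ 2) (K * h / 3)
  have hcongr := intervalIntegral.integral_congr (μ := MeasureTheory.volume) (a := 0) (b := t₀)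
    (f := fun t => Real.exp (-damping k lam t) *
      (K * h / 3 * (t ^ 2 * (η + (-(0.187 * η) + ρ * (0.375 / h) - 0.00092 * h) * (K * t ^ 2) +
        (-(ρ * (lam / 24 + 0.0089 / h)) - 0.00066 * h) * (K * t ^ 2) ^ 2 +
        (-(η * ((lam * h) ^ 2 / 1152)) - 0.000057 * lam * h ^ 2) * (K * t ^ 2) ^ 3))))
    (g := fun t => Real.exp (-damping k lam t) * (K * h / 3 * (t ^ 2 *
      (η * (1 - 0.187 * (K * t ^ 2) - (lam * h) ^ 2 / 1152 * (K * t ^ 2) ^ 3) +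
      ρ * (0.375 / h * (K * t ^ 2) - (lam / 24 + 0.0089 / h) * (K * t ^ 2) ^ 2) -
      (0.00092 * h * (K * t ^ 2) + 0.00066 * h * (K * t ^ 2) ^ 2 +
        0.000057 * lam * h ^ 2 * (K * t ^ 2) ^ 3))))) fun t _ => by
      ring
  rw [← hcongr, e] at hcore
  obtain ⟨b₁, b₂, -, b₄⟩ := core_budget hlam hh2 hT hρ0 (by linarith) (p 1) (p 2)
    r₁ r₂ r₃
  have b₅ : 1 / 16 * (0.898 * coreMoment k lam K t₀ 0) ≤ η * (coreMoment k lam K t₀ 0 -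
      0.187 * coreMoment k lam K t₀ 1 - (lam * h) ^ 2 / 1152 * coreMoment k lam K t₀ 3) :=
    mul_le_mul hη0 b₁ (by linarith [p 0]) (by linarith)
  have hpos : 0 < K * h / 3 * (0.006 * coreMoment k lam K t₀ 0) := by
    have := p 0
    positivity
  have hbound := mul_le_mul_of_nonneg_left (show 0.007 * coreMoment k lam K t₀ 0 ≤
      η * coreMoment k lam K t₀ 0 +
      (-(0.187 * η) + ρ * (0.375 / h) - 0.00092 * h) * coreMoment k lam K t₀ 1 +
      (-(ρ * (lam / 24 + 0.0089 / h)) - 0.00066 * h) * coreMoment k lam K t₀ 2 +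
      (-(η * ((lam * h) ^ 2 / 1152)) - 0.000057 * lam * h ^ 2) * coreMoment k lam K t₀ 3 by
    linarith [p 0]) (show 0 ≤ K * h / 3 by positivity)
  linarith

theorem integral_steinDefect_neg (hk : 2 ≤ k) (hK : K = (k : ℝ) * (k + 1))
    (hh : h = (k : ℝ) + 1 / 2) (hδ : δ * (8 * h) = 3 * K) (hlam : 2 ≤ lam)
    (hT : 48 ≤ lam * h) (hη0 : 1 / 20 ≤ η) (hη1 : η ≤ 1) :
    (∫ t in (0 : ℝ)..Real.pi,
      Real.exp (-damping k lam t) * steinDefect k lam K h δ (-η) t) < 0 := by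
  obtain ⟨t₀, ht₀, hKt, htpi⟩ := exists_core_radius hk hK
  obtain ⟨hh2, hK6, hhK, -, -, hρ0, hρ⟩ := delta_bounds hk hK hh hδ
  have hint : ∀ a b, IntervalIntegrable (fun t => Real.exp (-damping k lam t) *
      steinDefect k lam K h δ (-η) t) MeasureTheory.volume a b := fun a b =>
    Continuous.intervalIntegrable (by fun_prop) _ _
  rw [← intervalIntegral.integral_add_adjacent_intervals (hint 0 t₀) (hint t₀ Real.pi)]
  have htail := (abs_le.mp (abs_tail_le (δ := δ) (η := -η) hk hK hh hlam hT ht₀ hKt htpi)).2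
  obtain ⟨r₁, r₂, r₃⟩ := coreMoment_ratios hk hK hh hT ht₀ hKt
  have hK0 : 0 < K := by linarith
  have p := coreMoment_pos (k := k) (lam := lam) hK0 ht₀
  have hcore := intervalIntegral.integral_mono_on (μ := MeasureTheory.volume) ht₀.le
    (Continuous.intervalIntegrable (by fun_prop) _ _)
    (Continuous.intervalIntegrable (by fun_prop) _ _) fun t ht =>
      mul_le_mul_of_nonneg_left (steinDefect_le hk hK hh hδ (by linarith : 0 < lam) ht.1
        (by rw [← hKt]; have := ht.1; have := ht.2; gcongr) (by linarith : 0 ≤ η) hη1)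
        (Real.exp_nonneg (-damping k lam t))
  simp only [mul_neg, intervalIntegral.integral_neg] at hcore
  set ρ := (3 * K - 1) / 30 - 1 / 24 - δ ^ 2 / 2
  have e := integral_core_eq (k := k) (lam := lam) (K := K) (t₀ := t₀)
    (η - ρ * (1.32 / (lam * h ^ 2)))
    (-(0.187 * η) + ρ / 4 * (0.375 / h) - 0.00092 * h) (-(ρ / 4 * (lam / 24)) - 0.00066 * h)
    (-(η * ((lam * h) ^ 2 / 1152)) - 0.000057 * lam * h ^ 2) (K * h / 3)
  have hcongr := intervalIntegral.integral_congr (μ := MeasureTheory.volume) (a := 0) (b := t₀)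
    (f := fun t => Real.exp (-damping k lam t) *
      (K * h / 3 * (t ^ 2 * (η - ρ * (1.32 / (lam * h ^ 2)) +
        (-(0.187 * η) + ρ / 4 * (0.375 / h) - 0.00092 * h) * (K * t ^ 2) +
        (-(ρ / 4 * (lam / 24)) - 0.00066 * h) * (K * t ^ 2) ^ 2 +
        (-(η * ((lam * h) ^ 2 / 1152)) - 0.000057 * lam * h ^ 2) * (K * t ^ 2) ^ 3))))
    (g := fun t => Real.exp (-damping k lam t) * (K * h / 3 * (t ^ 2 *
      (η * (1 - 0.187 * (K * t ^ 2) - (lam * h) ^ 2 / 1152 * (K * t ^ 2) ^ 3) -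
      ρ * (1.32 / (lam * h ^ 2)) + ρ / 4 * (0.375 / h * (K * t ^ 2) - lam / 24 * (K * t ^ 2) ^ 2) -
      (0.00092 * h * (K * t ^ 2) + 0.00066 * h * (K * t ^ 2) ^ 2 +
        0.000057 * lam * h ^ 2 * (K * t ^ 2) ^ 3))))) fun t _ => by
      ring
  rw [← hcongr, e] at hcore
  obtain ⟨b₁, b₂, b₃, b₄⟩ := core_budget hlam hh2 hT hρ0 (by linarith) (p 1) (p 2)
    r₁ r₂ r₃
  have b₅ : 1 / 20 * (0.898 * coreMoment k lam K t₀ 0) ≤ η * (coreMoment k lam K t₀ 0 -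
      0.187 * coreMoment k lam K t₀ 1 - (lam * h) ^ 2 / 1152 * coreMoment k lam K t₀ 3) :=
    mul_le_mul hη0 b₁ (by linarith [p 0]) (by linarith)
  have b₆ := mul_le_mul_of_nonneg_right b₃ (p 0).le
  have b₇ : 0 ≤ ρ * (0.0089 / h * coreMoment k lam K t₀ 2) := by
    have := p 2
    positivity
  have hpos : 0 < K * h / 3 * (0.006 * coreMoment k lam K t₀ 0) := by
    have := p 0
    positivity
  have hbound := mul_le_mul_of_nonneg_left (show 0.007 * coreMoment k lam K t₀ 0 ≤
      (η - ρ * (1.32 / (lam * h ^ 2))) * coreMoment k lam K t₀ 0 +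
      (-(0.187 * η) + ρ / 4 * (0.375 / h) - 0.00092 * h) * coreMoment k lam K t₀ 1 +
      (-(ρ / 4 * (lam / 24)) - 0.00066 * h) * coreMoment k lam K t₀ 2 +
      (-(η * ((lam * h) ^ 2 / 1152)) - 0.000057 * lam * h ^ 2) * coreMoment k lam K t₀ 3 by
    linarith [p 0]) (show 0 ≤ K * h / 3 by positivity)
  linarith

end Combine

section Link

variable {k n : ℕ} {lam K h δ η : ℝ}

theorem damping_eq_sub_cosSum (k : ℕ) (lam t : ℝ) : damping k lam t = k * lam - cosSum k lam t := by
  simp only [damping, cosSum, Finset.sum_sub_distrib, Finset.sum_const, Finset.card_range,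
    nsmul_eq_mul]
  ring

theorem phase_eq_sub_sinSum (hK : K = (k : ℝ) * (k + 1)) (hn : lam * K = 2 * n) (t : ℝ) :
    phase k lam t = n * t - sinSum k lam t := by
  simp only [phase, sinSum, Finset.sum_sub_distrib]
  rw [← Finset.sum_mul, sum_succ_pow_one, ← hK, mul_sub]
  linear_combination t / 2 * hn

theorem integral_exp_neg_damping_mul_cos (hK : K = (k : ℝ) * (k + 1)) (hn : lam * K = 2 * n)
    (m : ℕ) :
    (∫ t in (0 : ℝ)..Real.pi, Real.exp (-damping k lam t) *
      Real.cos (((n : ℝ) - m) * t - phase k lam t)) =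
      Real.exp (-(k * lam)) * (Real.pi * orderKCoeff k lam m) := by
  rw [← fourierCoeffInt_eq_pi_mul_orderKCoeff, fourierCoeffInt,
    ← intervalIntegral.integral_const_mul]
  refine intervalIntegral.integral_congr fun t _ => ?_
  rw [damping_eq_sub_cosSum, phase_eq_sub_sinSum hK hn, ← mul_assoc, ← Real.exp_add]
  congr 2
  · ring
  · push_cast; ring

theorem integral_stein_eq_zero (hK : K = (k : ℝ) * (k + 1)) (hn : lam * K = 2 * n)
    (hlam : 0 < lam) (hkn : k ≤ n) :
    (∫ t in (0 : ℝ)..Real.pi, Real.exp (-damping k lam t) *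
      (steinSin k δ t * Real.sin (δ * t - phase k lam t) +
        steinCos k δ t * Real.cos (δ * t - phase k lam t))) = 0 := by
  have e : ∀ t : ℝ, Real.exp (-damping k lam t) *
      (steinSin k δ t * Real.sin (δ * t - phase k lam t) +
        steinCos k δ t * Real.cos (δ * t - phase k lam t)) =
      ∑ j ∈ Finset.range k, ((j : ℝ) + 1) * (Real.exp (-damping k lam t) *
        Real.cos (((n : ℝ) - n) * t - phase k lam t) - Real.exp (-damping k lam t) *
        Real.cos (((n : ℝ) - (n - (j + 1) : ℕ)) * t - phase k lam t)) := by
    intro t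
    unfold steinSin steinCos
    rw [Finset.sum_mul, Finset.sum_mul, ← Finset.sum_add_distrib, Finset.mul_sum]
    refine Finset.sum_congr rfl fun j hj => ?_
    have hj' : j + 1 ≤ n := by have := Finset.mem_range.mp hj; omega
    have e1 : ((n : ℝ) - n) * t - phase k lam t = δ * t - phase k lam t - δ * t := by ring
    have e2 : ((n : ℝ) - (n - (j + 1) : ℕ)) * t - phase k lam t =
        δ * t - phase k lam t + ((j : ℝ) + 1 - δ) * t := by
      rw [Nat.cast_sub hj']; push_cast; ring
    rw [e1, e2, Real.cos_sub (δ * t - phase k lam t), Real.cos_add]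
    ring
  have hI : ∀ m : ℕ, IntervalIntegrable (fun t => Real.exp (-damping k lam t) *
      Real.cos (((n : ℝ) - m) * t - phase k lam t)) MeasureTheory.volume 0 Real.pi := fun m =>
    Continuous.intervalIntegrable (by fun_prop) _ _
  rw [intervalIntegral.integral_congr fun t _ => e t, intervalIntegral.integral_finsetSum
    fun j _ => ((hI n).sub (hI _)).const_mul _]
  have hterm : ∀ j ∈ Finset.range k, (∫ t in (0 : ℝ)..Real.pi, ((j : ℝ) + 1) *
      (Real.exp (-damping k lam t) * Real.cos (((n : ℝ) - n) * t - phase k lam t) -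
        Real.exp (-damping k lam t) *
        Real.cos (((n : ℝ) - (n - (j + 1) : ℕ)) * t - phase k lam t))) =
      Real.exp (-(k * lam)) * Real.pi * (((j : ℝ) + 1) * orderKCoeff k lam n -
        ((j : ℝ) + 1) * orderKCoeff k lam (n - (j + 1))) := fun j _ => by
    rw [intervalIntegral.integral_const_mul, intervalIntegral.integral_sub (hI n) (hI _),
      integral_exp_neg_damping_mul_cos hK hn, integral_exp_neg_damping_mul_cos hK hn]
    ring
  rw [Finset.sum_congr rfl hterm, ← Finset.mul_sum, Finset.sum_sub_distrib, ← Finset.sum_mul,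
    sum_succ_pow_one, ← hK]
  have hrec := orderKCoeff_recurrence k lam n
  have hrec' : (n : ℝ) * orderKCoeff k lam n =
      lam * ∑ j ∈ Finset.range k, ((j : ℝ) + 1) * orderKCoeff k lam (n - (j + 1)) := by
    rw [hrec, Finset.mul_sum]
    refine Finset.sum_congr rfl fun j hj => ?_
    rw [if_pos (by have := Finset.mem_range.mp hj; omega)]
    ring
  have hz : K / 2 * orderKCoeff k lam n -
      ∑ j ∈ Finset.range k, ((j : ℝ) + 1) * orderKCoeff k lam (n - (j + 1)) = 0 := by
    refine (mul_eq_zero.mp ?_).resolve_left hlam.ne'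
    linear_combination hrec' + orderKCoeff k lam n / 2 * hn
  rw [hz, mul_zero]

theorem integral_steinDefect_eq (hK : K = (k : ℝ) * (k + 1)) (hn : lam * K = 2 * n)
    (hlam : 0 < lam) (hkn : k ≤ n) {m : ℕ} (hm : δ + η = n - m - 1 / 2) :
    (∫ t in (0 : ℝ)..Real.pi, Real.exp (-damping k lam t) * steinDefect k lam K h δ η t) =
      K * h / 3 * (Real.exp (-(k * lam)) * Real.pi) *
        (orderKCoeff k lam (m + 1) - orderKCoeff k lam m) := by
  have hI : ∀ m : ℕ, IntervalIntegrable (fun t => Real.exp (-damping k lam t) *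
      Real.cos (((n : ℝ) - m) * t - phase k lam t)) MeasureTheory.volume 0 Real.pi := fun m =>
    Continuous.intervalIntegrable (by fun_prop) _ _
  have e : ∀ t : ℝ, Real.exp (-damping k lam t) * steinDefect k lam K h δ η t =
      K * h / 3 * (Real.exp (-damping k lam t) *
        Real.cos (((n : ℝ) - (m + 1 : ℕ)) * t - phase k lam t) - Real.exp (-damping k lam t) *
        Real.cos (((n : ℝ) - m) * t - phase k lam t)) -
      Real.exp (-damping k lam t) * (steinSin k δ t * Real.sin (δ * t - phase k lam t) +
        steinCos k δ t * Real.cos (δ * t - phase k lam t)) := by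
    intro t
    have e1 : ((n : ℝ) - (m + 1 : ℕ)) * t - phase k lam t =
        (δ + η) * t - phase k lam t - t / 2 := by
      rw [hm]; push_cast; ring
    have e2 : ((n : ℝ) - m) * t - phase k lam t = (δ + η) * t - phase k lam t + t / 2 := by
      rw [hm]; ring
    rw [e1, e2, Real.cos_sub ((δ + η) * t - phase k lam t), Real.cos_add, steinDefect]
    ring
  rw [intervalIntegral.integral_congr fun t _ => e t, intervalIntegral.integral_sub
    (((hI _).sub (hI _)).const_mul _) (Continuous.intervalIntegrable (by fun_prop) _ _),
    integral_stein_eq_zero hK hn hlam hkn, intervalIntegral.integral_const_mul,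
    intervalIntegral.integral_sub (hI _) (hI _),
    integral_exp_neg_damping_mul_cos hK hn, integral_exp_neg_damping_mul_cos hK hn]
  ring

theorem orderKCoeff_lt_succ (hk : 2 ≤ k) (hK : K = (k : ℝ) * (k + 1))
    (hh : h = (k : ℝ) + 1 / 2) (hδ : δ * (8 * h) = 3 * K) (hn : lam * K = 2 * n)
    (hlam : 2 ≤ lam) (hT : 48 ≤ lam * h) (hkn : k ≤ n) {m : ℕ}
    (h0 : δ + 1 / 16 ≤ n - m - 1 / 2) (h1 : n - m - 1 / 2 ≤ δ + 1) :
    orderKCoeff k lam m < orderKCoeff k lam (m + 1) := by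
  have hpos := integral_steinDefect_pos (η := (n : ℝ) - m - 1 / 2 - δ) hk hK hh hδ hlam hT
    (by linarith) (by linarith)
  rw [integral_steinDefect_eq hK hn (by linarith) hkn (m := m) (by ring)] at hpos
  have hS : 0 ≤ K * h / 3 * (Real.exp (-(k * lam)) * Real.pi) := by
    have := Real.pi_pos
    rw [hK, hh]; positivity
  exact sub_pos.mp (pos_of_mul_pos_right hpos hS)

theorem orderKCoeff_succ_lt (hk : 2 ≤ k) (hK : K = (k : ℝ) * (k + 1))
    (hh : h = (k : ℝ) + 1 / 2) (hδ : δ * (8 * h) = 3 * K) (hn : lam * K = 2 * n)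
    (hlam : 2 ≤ lam) (hT : 48 ≤ lam * h) (hkn : k ≤ n) {m : ℕ}
    (h0 : n - m - 1 / 2 ≤ δ - 1 / 20) (h1 : δ - 1 ≤ n - m - 1 / 2) :
    orderKCoeff k lam (m + 1) < orderKCoeff k lam m := by
  have hneg := integral_steinDefect_neg (η := δ - ((n : ℝ) - m - 1 / 2)) hk hK hh hδ hlam hT
    (by linarith) (by linarith)
  rw [integral_steinDefect_eq hK hn (by linarith) hkn (m := m) (by ring)] at hneg
  have hS : 0 ≤ K * h / 3 * (Real.exp (-(k * lam)) * Real.pi) := by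
    have := Real.pi_pos
    rw [hK, hh]; positivity
  by_contra hcon
  push Not at hcon
  have := mul_nonneg hS (sub_nonneg.mpr hcon)
  linarith

end Link

section Mode

theorem orderKCoeff_logConcave {k : ℕ} {lam : ℝ} (hk : 1 ≤ k) (hlam : 2 ≤ lam) (m : ℕ) :
    orderKCoeff k lam m * orderKCoeff k lam (m + 2) ≤ orderKCoeff k lam (m + 1) ^ 2 := by
  have hr0 : ∀ j, 0 ≤ (if j < k then lam * ((j : ℝ) + 1) else 0) := fun j => by
    split_ifs
    · positivity
    · exact le_rfl
  refine logConcave_of_recurrence (r := fun j => if j < k then lam * ((j : ℝ) + 1) else 0)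
    (fun m => orderKCoeff_pos hk (by linarith) m) (fun i j hij => ?_) ?_ (fun m => ?_) m
  · by_cases hj : j + 1 < k
    · have hij' : (i : ℝ) ≤ j := by exact_mod_cast hij.le
      simp only [if_pos hj, if_pos (by omega : j < k), if_pos (by omega : i < k),
        if_pos (by omega : i + 1 < k)]
      push_cast
      nlinarith [mul_nonneg (sq_nonneg lam) (sub_nonneg.mpr hij')]
    · simp only [if_neg hj, mul_zero]
      exact mul_nonneg (hr0 j) (hr0 (i + 1))
  · simp only [if_pos (by omega : 0 < k)]
    split_ifs
    · push_cast; nlinarith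
    · positivity
  · have h := orderKCoeff_recurrence k lam (m + 1)
    push_cast at h
    have e1 : ∀ i, (if i ≤ m then lam * ((i : ℝ) + 1) * orderKCoeff k lam (m - i) else 0) =
        if i ∈ Finset.range (m + 1) then lam * ((i : ℝ) + 1) * orderKCoeff k lam (m - i) else 0 := by
      intro i
      simp only [Finset.mem_range, Nat.lt_succ_iff]
    have e2 : ∀ j, (if j < k then lam * ((j : ℝ) + 1) else 0) * orderKCoeff k lam (m - j) =
        if j ∈ Finset.range k then lam * ((j : ℝ) + 1) * orderKCoeff k lam (m - j) else 0 := by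
      intro j
      simp only [Finset.mem_range, ite_mul, zero_mul]
    rw [h, Finset.sum_congr rfl fun i _ => e1 i, Finset.sum_ite_mem,
      Finset.sum_congr rfl fun j _ => e2 j, Finset.sum_ite_mem, Finset.inter_comm]

theorem orderKCoeff_neighbors_lt_of_large {k n c : ℕ} {lam : ℝ} (hk : 2 ≤ k)
    (hkn : k * (k + 1) ≤ n) (hlam : lam * ((k : ℝ) * (k + 1)) = 2 * n)
    (hT : 48 ≤ lam * ((k : ℝ) + 1 / 2)) (hc : c + 1 + (3 * k + 5) / 8 = n) :
    orderKCoeff k lam c < orderKCoeff k lam (c + 1) ∧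
      orderKCoeff k lam (c + 2) < orderKCoeff k lam (c + 1) := by
  have hk' : (2 : ℝ) ≤ k := by exact_mod_cast hk
  have hkn' : (k : ℝ) * (k + 1) ≤ n := by exact_mod_cast hkn
  have hlam2 : 2 ≤ lam := by
    by_contra hcon
    have : 0 < (k : ℝ) * (k + 1) := by positivity
    nlinarith
  have hkn1 : k ≤ n := by nlinarith
  obtain ⟨g, hg⟩ : ∃ g : ℝ, g = 3 / (16 * (2 * k + 1)) := ⟨_, rfl⟩
  have hg0 : 0 < g := by rw [hg]; positivity
  have hg1 : g * (16 * (2 * k + 1)) = 3 := by rw [hg]; field_simp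
  have hg2 : g ≤ 3 / 80 := by nlinarith
  have hδ : (3 * (k : ℝ) / 8 + 3 / 16 - g) * (8 * ((k : ℝ) + 1 / 2)) = 3 * ((k : ℝ) * (k + 1)) := by
    linear_combination -hg1 / 4
  obtain ⟨D, hD⟩ : ∃ D, D = (3 * k + 5) / 8 := ⟨_, rfl⟩
  rw [← hD] at hc
  have hc' : (n : ℝ) = c + 1 + D := by exact_mod_cast hc.symm
  have hDle : 8 * (D : ℝ) ≤ 3 * k + 5 := by
    have : 8 * D ≤ 3 * k + 5 := by omega
    exact_mod_cast this
  have hDge : 3 * (k : ℝ) + 5 ≤ 8 * D + 7 := by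
    have : 3 * k + 5 ≤ 8 * D + 7 := by omega
    exact_mod_cast this
  refine ⟨orderKCoeff_lt_succ hk rfl rfl hδ hlam hlam2 hT hkn1 ?_ ?_,
    orderKCoeff_succ_lt hk rfl rfl hδ hlam hlam2 hT hkn1 ?_ ?_⟩
  · linarith
  · linarith
  · push_cast
    rcases lt_or_ge k 9 with hk9 | hk9
    · have : 8 * D + 1 ≤ 3 * k + 5 := by omega
      have : 8 * (D : ℝ) + 1 ≤ 3 * k + 5 := by exact_mod_cast this
      linarith
    · have hk9' : (9 : ℝ) ≤ k := by exact_mod_cast hk9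
      have hg3 : g ≤ 1 / 80 := by nlinarith
      linarith
  · push_cast
    linarith

end Mode

section FixedPoint

/-- Evaluate a natural number before passing it on. -/
def forceNat {α : Type} (x : ℕ) (f : ℕ → α) : α :=
  Nat.casesOn x (f 0) fun a => f (Nat.succ a)

theorem forceNat_eq {α : Type} (x : ℕ) (f : ℕ → α) : forceNat x f = f x := by
  cases x <;> rfl

/-- The weights `1, …, k`, packed in base `B` in decreasing order. -/
def packedWeights (B k : ℕ) : ℕ :=
  Nat.rec 0 (fun i r => Nat.add (Nat.mul r B) (Nat.succ i)) k

/-- One step of the fixed-point recurrence for the coefficients. The last `k + 1` values are packed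
in base `B` in the window `W`; the constants are `C = packedWeights B k`, `P = B ^ (k - 1)` and
`Q = B ^ (k + 1)`. -/
def packedStep (n q B C P Q m W : ℕ) : ℕ :=
  Nat.mod (Nat.add (Nat.mul W B) (Nat.div (Nat.mul n (Nat.mod (Nat.div (Nat.mul W C) P) B))
    (Nat.mul q m))) Q

/-- The last `fuel` of `N` steps of the fixed-point recurrence. -/
def packedLoop (n q B C P Q N fuel : ℕ) : ℕ → ℕ :=
  Nat.rec (motive := fun _ => ℕ → ℕ) (fun W => W)
    (fun i ih W => forceNat (packedStep n q B C P Q (Nat.sub N i) W) ih) fuel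

/-- Compare three consecutive entries of the window, allowing for the rounding errors. -/
def windowPeaks (B s n W : ℕ) : Bool :=
  (Nat.blt (Nat.mul (Nat.mod (Nat.div W (Nat.mul B B)) B) s)
    (Nat.mul (Nat.mod (Nat.div W B) B) (Nat.sub s n))).and
  (Nat.blt (Nat.mul (Nat.mod W B) s) (Nat.mul (Nat.mod (Nat.div W B) B) (Nat.sub s n)))

/-- Fixed-point check that the coefficients for `λ = 2n / (k(k+1))` have a strict peak at
`n - (3k + 5) / 8`. -/
def peakCheck (k n : ℕ) : Bool :=
  forceNat (2 ^ 128) fun B => forceNat (B ^ (k - 1)) fun P => forceNat (P * B * B) fun Q =>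
  forceNat (k * (k + 1) / 2) fun q => forceNat (packedWeights B k) fun C => forceNat n fun n =>
  forceNat (n - (3 * k + 5) / 8 + 1) fun N => forceNat (2 ^ 40) fun s =>
  forceNat (packedLoop n q B C P Q N N s) (windowPeaks B s n)

/-- The check `peakCheck k n` for all `n` with `k (k + 1) ≤ n` and `λ (k + 1 / 2) < 48`, where
`λ = 2n / (k(k+1))`. -/
def peakCheckRow (k : ℕ) : Bool :=
  (List.range 564).all fun n =>
    Nat.blt n (k * (k + 1)) || Nat.ble (48 * (k * (k + 1))) (n * (2 * k + 1)) || peakCheck k n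

theorem peakCheckRow_of_small {k : ℕ} (hk : 2 ≤ k) (hk24 : k < 24) : peakCheckRow k = true := by
  interval_cases k <;> decide +kernel

end FixedPoint

section FixedPointCorrect

open Polynomial in
theorem eval_div_pow_mod {B : ℕ} (hB : 0 < B) (p : ℕ[X]) (hp : ∀ i, p.coeff i < B) (i : ℕ) :
    p.eval B / B ^ i % B = p.coeff i := by
  induction i generalizing p with
  | zero =>
    nth_rewrite 1 [← p.divX_mul_X_add]
    rw [eval_add, eval_mul, eval_X, eval_C, pow_zero, Nat.div_one, Nat.mul_add_mod_self_right,
      Nat.mod_eq_of_lt (hp 0)]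
  | succ i ih =>
    have h := ih p.divX fun j => by rw [coeff_divX]; exact hp _
    rw [coeff_divX] at h
    nth_rewrite 1 [← p.divX_mul_X_add]
    rw [eval_add, eval_mul, eval_X, eval_C, pow_succ', ← Nat.div_div_eq_div_mul,
      mul_comm, Nat.mul_add_div hB, Nat.div_eq_of_lt (hp 0), add_zero, h]

open Polynomial in
theorem coeff_le_eval_one (p : ℕ[X]) (i : ℕ) : p.coeff i ≤ p.eval 1 := by
  by_cases hi : i ∈ p.support
  · rw [eval_eq_sum, Polynomial.sum]
    refine le_trans ?_ (Finset.single_le_sum (f := fun e => p.coeff e * 1 ^ e)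
      (fun _ _ => Nat.zero_le _) hi)
    simp
  · rw [notMem_support_iff.mp hi]; exact Nat.zero_le _

/-- A window packed in base `B`. -/
def packed (B : ℕ) (g : ℕ → ℕ) (N : ℕ) : ℕ := ∑ j ∈ Finset.range N, g j * B ^ j

open Polynomial in
/-- The polynomial with the given coefficients below `N`. -/
noncomputable def packedPoly (g : ℕ → ℕ) (N : ℕ) : ℕ[X] :=
  ∑ j ∈ Finset.range N, C (g j) * X ^ j

theorem eval_packedPoly (B : ℕ) (g : ℕ → ℕ) (N : ℕ) :
    (packedPoly g N).eval B = packed B g N := by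
  simp [packedPoly, packed, Polynomial.eval_finsetSum]

theorem coeff_packedPoly (g : ℕ → ℕ) (N i : ℕ) :
    (packedPoly g N).coeff i = if i < N then g i else 0 := by
  simp [packedPoly, Polynomial.coeff_X_pow]

theorem packed_lt {B : ℕ} {g : ℕ → ℕ} (N : ℕ) (hg : ∀ j < N, g j < B) : packed B g N < B ^ N := by
  induction N with
  | zero => simp [packed]
  | succ N ih =>
    have h1 := ih fun j hj => hg j (by omega)
    have h2 := hg N (by omega)
    unfold packed at *
    rw [Finset.sum_range_succ, pow_succ]
    calc _ < B ^ N + g N * B ^ N := by omega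
      _ = (g N + 1) * B ^ N := by ring
      _ ≤ B * B ^ N := Nat.mul_le_mul_right _ h2
      _ = _ := mul_comm _ _

theorem packed_div_pow_mod {B : ℕ} {g : ℕ → ℕ} {N : ℕ} (hB : 0 < B) (hg : ∀ j < N, g j < B)
    {i : ℕ} (hi : i < N) : packed B g N / B ^ i % B = g i := by
  rw [← eval_packedPoly, eval_div_pow_mod hB, coeff_packedPoly, if_pos hi]
  intro j
  rw [coeff_packedPoly]
  split_ifs with h
  · exact hg j h
  · exact hB

theorem packed_mul_add_mod {B f : ℕ} {g : ℕ → ℕ} {N : ℕ} (hg : ∀ j < N, g j < B) (hf : f < B) :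
    (packed B g (N + 1) * B + f) % B ^ (N + 1) =
      packed B (fun j => Nat.casesOn j f g) (N + 1) := by
  have h : packed B g (N + 1) * B + f =
      packed B (fun j => Nat.casesOn j f g) (N + 1) + B ^ (N + 1) * g N := by
    unfold packed
    rw [Finset.sum_range_succ, Finset.sum_range_succ', add_mul, Finset.sum_mul]
    simp only [pow_zero, mul_one, pow_succ, mul_assoc]
    generalize ∑ j ∈ Finset.range N, g j * (B ^ j * B) = S
    rw [add_right_comm, mul_left_comm, mul_comm (g N)]
    rfl
  rw [h, Nat.add_mul_mod_self_left, Nat.mod_eq_of_lt]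
  refine packed_lt _ fun j hj => ?_
  cases j with
  | zero => exact hf
  | succ j => exact hg j (by omega)

theorem packedWeights_eq (B k : ℕ) : packedWeights B k = packed B (fun j => k - j) k := by
  induction k with
  | zero => rfl
  | succ k ih =>
    have h : packedWeights B (k + 1) = packedWeights B k * B + (k + 1) := rfl
    rw [h, ih, packed, packed, Finset.sum_range_succ', Finset.sum_mul]
    simp only [Nat.add_sub_add_right, pow_succ, mul_assoc, pow_zero, mul_one, Nat.sub_zero]

theorem packed_mul_weights_div_mod {B G k : ℕ} {g : ℕ → ℕ} (hk : 1 ≤ k)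
    (hg : ∀ j ≤ k, g j ≤ G) (hB : (k + 1) * G * (k * k) < B) :
    packed B g (k + 1) * packedWeights B k / B ^ (k - 1) % B =
      ∑ j ∈ Finset.range k, (j + 1) * g j := by
  rw [packedWeights_eq, ← eval_packedPoly, ← eval_packedPoly, ← Polynomial.eval_mul,
    eval_div_pow_mod (by omega), Polynomial.coeff_mul,
    Finset.Nat.sum_antidiagonal_eq_sum_range_succ fun a b =>
      (packedPoly g (k + 1)).coeff a * (packedPoly (fun j => k - j) k).coeff b,
    Nat.succ_eq_add_one, Nat.sub_add_cancel hk]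
  · refine Finset.sum_congr rfl fun j hj => ?_
    have hj' := Finset.mem_range.mp hj
    rw [coeff_packedPoly, coeff_packedPoly, if_pos (by omega), if_pos (by omega), mul_comm]
    congr 1
    omega
  · intro i
    refine (coeff_le_eval_one _ i).trans_lt (lt_of_le_of_lt ?_ hB)
    rw [Polynomial.eval_mul, ← Nat.cast_one, Nat.cast_id, eval_packedPoly, eval_packedPoly]
    unfold packed
    simp only [one_pow, mul_one]
    refine Nat.mul_le_mul ?_ ?_
    · refine (Finset.sum_le_card_nsmul _ _ G fun j hj => hg j ?_).trans_eq (by simp)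
      have := Finset.mem_range.mp hj
      omega
    · exact (Finset.sum_le_card_nsmul _ _ k fun j _ => Nat.sub_le _ _).trans_eq (by simp)

end FixedPointCorrect

section FixedPointSpec

variable {k n : ℕ} {lam : ℝ}

theorem orderKCoeff_le_exp (hlam : 0 ≤ lam) (m : ℕ) :
    orderKCoeff k lam m ≤ Real.exp (k * lam) := by
  have h := fourierCoeffInt_eq_pi_mul_orderKCoeff k lam m
  unfold fourierCoeffInt at h
  have hb := intervalIntegral.norm_integral_le_of_norm_le_const (a := 0) (b := Real.pi)
    (C := Real.exp (k * lam))
    (f := fun t => Real.exp (cosSum k lam t) * Real.cos (sinSum k lam t - ((m : ℤ) : ℝ) * t))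
    fun t _ => by
      have h1 := damping_nonneg (k := k) (t := t) hlam
      rw [damping_eq_sub_cosSum] at h1
      rw [Real.norm_eq_abs, abs_mul, Real.abs_exp]
      calc _ ≤ Real.exp (k * lam) * 1 :=
            mul_le_mul (Real.exp_le_exp.mpr (by linarith)) (Real.abs_cos_le_one _)
              (abs_nonneg _) (Real.exp_nonneg _)
        _ = _ := mul_one _
  rw [h, sub_zero, abs_of_pos Real.pi_pos, mul_comm] at hb
  exact le_of_mul_le_mul_right ((le_abs_self _).trans hb) Real.pi_pos

theorem one_le_orderKCoeff (hn : lam * ((k : ℝ) * (k + 1)) = 2 * n) (hlam : 1 ≤ lam)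
    {m : ℕ} (hm : m ≤ n) : 1 ≤ orderKCoeff k lam m := by
  induction m using Nat.strong_induction_on with
  | _ m ih =>
    rcases Nat.eq_zero_or_pos m with rfl | hm0
    · rw [orderKCoeff_zero]
    have hm0' : (0 : ℝ) < m := by exact_mod_cast hm0
    have hmn : (m : ℝ) ≤ n := by exact_mod_cast hm
    have hrec := orderKCoeff_recurrence k lam m
    have hge : ∀ i ∈ Finset.range k, (if i + 1 ≤ m then lam * ((i : ℝ) + 1) else 0) ≤
        if i + 1 ≤ m then lam * ((i : ℝ) + 1) * orderKCoeff k lam (m - (i + 1)) else 0 := by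
      intro i _
      split_ifs with hi
      · exact le_mul_of_one_le_right (by positivity) (ih _ (by omega) (by omega))
      · exact le_rfl
    have hsum := Finset.sum_le_sum hge
    rw [← hrec] at hsum
    have hm1 : (m : ℝ) ≤ ∑ i ∈ Finset.range k, if i + 1 ≤ m then lam * ((i : ℝ) + 1) else 0 := by
      rcases le_total k m with hkm | hkm
      · rw [Finset.sum_congr rfl fun i hi =>
          if_pos (by have := Finset.mem_range.mp hi; omega : i + 1 ≤ m), ← Finset.mul_sum,
          sum_succ_pow_one]
        linarith
      · refine le_trans ?_ (Finset.single_le_sum (f := fun i : ℕ =>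
          if i + 1 ≤ m then lam * ((i : ℝ) + 1) else 0) (fun i _ => ?_)
          (Finset.mem_range.mpr (by omega : m - 1 < k)))
        · rw [if_pos (by omega)]
          have : ((m - 1 : ℕ) : ℝ) + 1 = m := by
            rw [Nat.cast_sub hm0]; simp
          rw [this]
          nlinarith
        · split_ifs
          · positivity
          · exact le_rfl
    by_contra hcon
    push Not at hcon
    nlinarith

/-- `g` lists fixed-point approximations, at scale `s`, of the coefficients from `m` downwards. -/
def WindowApprox (k : ℕ) (lam : ℝ) (s m : ℕ) (g : ℕ → ℕ) : Prop :=
  (∀ j ≤ m, ((s : ℝ) - (m - j : ℕ)) * orderKCoeff k lam (m - j) ≤ g j ∧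
    (g j : ℝ) ≤ s * orderKCoeff k lam (m - j)) ∧ ∀ j, m < j → g j = 0

theorem WindowApprox.succ {s m q : ℕ} {g : ℕ → ℕ} (hg : WindowApprox k lam s m g) (hk : 1 ≤ k)
    (hq : 2 * q = k * (k + 1)) (hn : lam * ((k : ℝ) * (k + 1)) = 2 * n) (hlam : 1 ≤ lam)
    (hm : m + 1 ≤ n) (hs : n ≤ s) :
    WindowApprox k lam s (m + 1) fun j => Nat.casesOn j
      (n * (∑ j ∈ Finset.range k, (j + 1) * g j) / (q * (m + 1))) g := by
  refine ⟨fun j hj => ?_, fun j hj => ?_⟩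
  swap
  · cases j with
    | zero => omega
    | succ j => exact hg.2 j (by omega)
  cases j with
  | succ j => simpa only [Nat.add_sub_add_right] using hg.1 j (by omega)
  | zero =>
    have hq' : 2 * (q : ℝ) = k * (k + 1) := by exact_mod_cast hq
    have hk' : (1 : ℝ) ≤ k := by exact_mod_cast hk
    have hq0 : 0 < (q : ℝ) := by nlinarith
    have hlq : lam * q = n := by linear_combination hn / 2 + lam / 2 * hq'
    have hms : (m : ℝ) + 1 ≤ s := by exact_mod_cast hm.trans hs
    have hrec := orderKCoeff_recurrence k lam (m + 1)
    have hsum : (s - m) * (((m + 1 : ℕ) : ℝ) * orderKCoeff k lam (m + 1)) ≤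
        lam * ((∑ j ∈ Finset.range k, (j + 1) * g j : ℕ) : ℝ) ∧
        lam * ((∑ j ∈ Finset.range k, (j + 1) * g j : ℕ) : ℝ) ≤
        s * (((m + 1 : ℕ) : ℝ) * orderKCoeff k lam (m + 1)) := by
      rw [hrec, Nat.cast_sum, Finset.mul_sum, Finset.mul_sum, Finset.mul_sum]
      refine ⟨Finset.sum_le_sum fun j _ => ?_, Finset.sum_le_sum fun j _ => ?_⟩
      · rw [Nat.add_sub_add_right]
        split_ifs with hj
        · have hj' : j ≤ m := by omega
          have h1 := (hg.1 j hj').1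
          have hpos := orderKCoeff_pos hk (by linarith : 0 < lam) (m - j)
          have h2 : ((s : ℝ) - m) * orderKCoeff k lam (m - j) ≤ g j := by
            refine le_trans (mul_le_mul_of_nonneg_right ?_ hpos.le) h1
            have : ((m - j : ℕ) : ℝ) ≤ m := by exact_mod_cast Nat.sub_le m j
            linarith
          have h3 := mul_le_mul_of_nonneg_left h2 (by positivity : 0 ≤ lam * ((j : ℝ) + 1))
          push_cast
          linarith
        · rw [mul_zero]; positivity
      · rw [Nat.add_sub_add_right]
        split_ifs with hj
        · have h1 := (hg.1 j (by omega)).2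
          have h3 := mul_le_mul_of_nonneg_left h1 (by positivity : 0 ≤ lam * ((j : ℝ) + 1))
          push_cast
          linarith
        · rw [hg.2 j (by omega)]
          simp
    simp only [Nat.sub_zero]
    set S := ∑ j ∈ Finset.range k, (j + 1) * g j
    have hT := one_le_orderKCoeff hn hlam hm
    have hd0 : (0 : ℝ) < q * (m + 1) := by positivity
    have hdnat : 0 < q * (m + 1) := by exact_mod_cast hd0
    have h1 : ((n * S / (q * (m + 1)) : ℕ) : ℝ) * (q * (m + 1)) ≤ n * S := by
      exact_mod_cast Nat.div_mul_le_self (n * S) (q * (m + 1))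
    have h2 : (n : ℝ) * S < (((n * S / (q * (m + 1)) : ℕ) : ℝ) + 1) * (q * (m + 1)) := by
      have := Nat.lt_mul_div_succ (n * S) hdnat
      rw [mul_comm (q * (m + 1))] at this
      exact_mod_cast this
    generalize ((n * S / (q * (m + 1)) : ℕ) : ℝ) = f at *
    obtain ⟨h3, h4⟩ := hsum
    push_cast at h3 h4 ⊢
    constructor
    · have h5 : (s - m) * orderKCoeff k lam (m + 1) < f + 1 := by
        have := mul_le_mul_of_nonneg_left h3 hq0.le
        refine lt_of_mul_lt_mul_right (lt_of_le_of_lt ?_ h2) hd0.le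
        rw [← hlq]
        linarith
      linarith
    · refine le_of_mul_le_mul_right (h1.trans ?_) hd0
      have := mul_le_mul_of_nonneg_left h4 hq0.le
      rw [← hlq]
      linarith

theorem exp_fortyEight_le : Real.exp 48 ≤ 2 ^ 70 := by
  have h : Real.exp 48 = Real.exp 1 ^ 48 := by rw [← Real.exp_nat_mul]; norm_num
  rw [h]
  calc _ ≤ (2.7182818286 : ℝ) ^ 48 := by
        have := Real.exp_one_lt_d9.le
        gcongr
    _ ≤ _ := by norm_num

theorem WindowApprox.le {m : ℕ} {g : ℕ → ℕ} (hg : WindowApprox k lam (2 ^ 40) m g)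
    (hlam : 0 ≤ lam) (hkl : k * lam ≤ 48) (j : ℕ) : g j ≤ 2 ^ 110 := by
  rcases le_or_gt j m with hj | hj
  · have h1 := (hg.1 j hj).2
    have h2 := (orderKCoeff_le_exp (k := k) hlam (m - j)).trans
      ((Real.exp_le_exp.mpr hkl).trans exp_fortyEight_le)
    have h3 : (g j : ℝ) ≤ 2 ^ 110 := by
      refine h1.trans ?_
      push_cast
      nlinarith
    exact_mod_cast h3
  · rw [hg.2 j hj]; exact Nat.zero_le _

theorem packedLoop_spec {q N fuel : ℕ} {g : ℕ → ℕ} (hk : 1 ≤ k) (hk24 : k < 24)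
    (hq : 2 * q = k * (k + 1)) (hn : lam * ((k : ℝ) * (k + 1)) = 2 * n) (hlam : 1 ≤ lam)
    (hkl : k * lam ≤ 48) (hN : N ≤ n) (hs : n ≤ 2 ^ 40) (hfuel : fuel ≤ N)
    (hg : WindowApprox k lam (2 ^ 40) (N - fuel) g) :
    ∃ g', WindowApprox k lam (2 ^ 40) N g' ∧
      packedLoop n q (2 ^ 128) (packedWeights (2 ^ 128) k) ((2 ^ 128) ^ (k - 1))
        ((2 ^ 128) ^ (k + 1)) N fuel (packed (2 ^ 128) g (k + 1)) = packed (2 ^ 128) g' (k + 1) := by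
  induction fuel generalizing g with
  | zero => exact ⟨g, hg, rfl⟩
  | succ fuel ih =>
    have hm : N - fuel = N - (fuel + 1) + 1 := by omega
    have hsucc := hg.succ hk hq hn hlam (by omega) hs
    have hle := hg.le (by linarith) hkl
    simp only [← hm] at hsucc
    have hfle := hsucc.le (by linarith) hkl 0
    have hstep : packedStep n q (2 ^ 128) (packedWeights (2 ^ 128) k) ((2 ^ 128) ^ (k - 1))
        ((2 ^ 128) ^ (k + 1)) (N - fuel) (packed (2 ^ 128) g (k + 1)) =
        packed (2 ^ 128) (fun j => Nat.casesOn j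
          (n * (∑ j ∈ Finset.range k, (j + 1) * g j) / (q * (N - fuel))) g) (k + 1) := by
      have hB : (k + 1) * 2 ^ 110 * (k * k) < 2 ^ 128 := by
        calc (k + 1) * 2 ^ 110 * (k * k) ≤ 24 * 2 ^ 110 * (23 * 23) := by gcongr <;> omega
          _ < _ := by norm_num
      have h1 := packed_mul_weights_div_mod hk (fun j _ => hle j) hB
      change (packed (2 ^ 128) g (k + 1) * 2 ^ 128 + n * (packed (2 ^ 128) g (k + 1) *
        packedWeights (2 ^ 128) k / (2 ^ 128) ^ (k - 1) % 2 ^ 128) / (q * (N - fuel))) %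
        (2 ^ 128) ^ (k + 1) = _
      rw [h1]
      exact packed_mul_add_mod (fun j _ => (hle j).trans_lt (by norm_num))
        (hfle.trans_lt (by norm_num))
    obtain ⟨g', hg', h'⟩ := ih (by omega) hsucc
    refine ⟨g', hg', ?_⟩
    rw [← h', ← hstep]
    exact forceNat_eq _ _

theorem orderKCoeff_neighbors_lt_of_peakCheck {c : ℕ} (hk : 2 ≤ k) (hk24 : k < 24)
    (hn : lam * ((k : ℝ) * (k + 1)) = 2 * n) (hlam : 1 ≤ lam) (hkl : k * lam ≤ 48)
    (hs : n < 2 ^ 40) (hc : c + 1 + (3 * k + 5) / 8 = n) (hcheck : peakCheck k n = true) :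
    orderKCoeff k lam c < orderKCoeff k lam (c + 1) ∧
      orderKCoeff k lam (c + 2) < orderKCoeff k lam (c + 1) := by
  have hq : 2 * (k * (k + 1) / 2) = k * (k + 1) := Nat.two_mul_div_two_of_even (Nat.even_mul_succ_self k)
  have hN : n - (3 * k + 5) / 8 + 1 = c + 2 := by omega
  have hQ : (2 ^ 128) ^ (k - 1) * 2 ^ 128 * 2 ^ 128 = (2 ^ 128) ^ (k + 1) := by
    rw [← pow_succ, ← pow_succ]; congr 1; omega
  have hinit : packed (2 ^ 128) (fun j => if j = 0 then 2 ^ 40 else 0) (k + 1) = 2 ^ 40 := by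
    rw [packed, Finset.sum_range_succ']
    simp
  have hg0 : WindowApprox k lam (2 ^ 40) (c + 2 - (c + 2)) fun j => if j = 0 then 2 ^ 40 else 0 := by
    refine ⟨fun j hj => ?_, fun j hj => if_neg (by omega)⟩
    have hj0 : j = 0 := by omega
    subst hj0
    simp [orderKCoeff_zero]
  obtain ⟨g, hg, hloop⟩ := packedLoop_spec (N := c + 2) (by omega) hk24 hq hn hlam hkl (by omega)
    hs.le le_rfl hg0
  rw [hinit] at hloop
  simp only [peakCheck, forceNat_eq] at hcheck
  rw [hN, hQ, hloop] at hcheck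
  have hlt : ∀ j < k + 1, g j < 2 ^ 128 := fun j _ =>
    (hg.le (by linarith) hkl j).trans_lt (by norm_num)
  have d0 := packed_div_pow_mod (by norm_num) hlt (by omega : 0 < k + 1)
  have d1 := packed_div_pow_mod (by norm_num) hlt (by omega : 1 < k + 1)
  have d2 := packed_div_pow_mod (by norm_num) hlt (by omega : 2 < k + 1)
  rw [pow_zero, Nat.div_one] at d0
  rw [pow_one] at d1
  rw [pow_two] at d2
  have hw : g 2 * 2 ^ 40 < g 1 * (2 ^ 40 - n) ∧ g 0 * 2 ^ 40 < g 1 * (2 ^ 40 - n) := by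
    have : (Nat.blt (packed (2 ^ 128) g (k + 1) / (2 ^ 128 * 2 ^ 128) % 2 ^ 128 * 2 ^ 40)
        (packed (2 ^ 128) g (k + 1) / 2 ^ 128 % 2 ^ 128 * (2 ^ 40 - n)) &&
        Nat.blt (packed (2 ^ 128) g (k + 1) % 2 ^ 128 * 2 ^ 40)
        (packed (2 ^ 128) g (k + 1) / 2 ^ 128 % 2 ^ 128 * (2 ^ 40 - n))) = true := hcheck
    rw [d0, d1, d2, Bool.and_eq_true, Nat.blt_eq, Nat.blt_eq] at this
    exact this
  have hcast : (((2 ^ 40 - n : ℕ)) : ℝ) = 2 ^ 40 - n := by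
    rw [Nat.cast_sub hs.le]; norm_num
  have hn40 : (n : ℝ) < 2 ^ 40 := by exact_mod_cast hs
  obtain ⟨w1, w2⟩ := hw
  rify at w1 w2
  rw [hcast] at w1 w2
  have a0 := (hg.1 0 (by omega)).1
  have a1 := (hg.1 1 (by omega)).2
  have a2 := (hg.1 2 (by omega)).1
  have hcn : (c : ℝ) + 2 ≤ n := by
    have : c + 2 ≤ n := by omega
    exact_mod_cast this
  have p0 := orderKCoeff_pos (by omega : 1 ≤ k) (by linarith : 0 < lam) (c + 2)
  have p2 := orderKCoeff_pos (by omega : 1 ≤ k) (by linarith : 0 < lam) c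
  simp only [Nat.sub_zero, Nat.add_sub_cancel, show c + 2 - 1 = c + 1 by omega] at a0 a1 a2
  push_cast at a0 a1 a2
  generalize orderKCoeff k lam c = T₀ at *
  generalize orderKCoeff k lam (c + 1) = T₁ at *
  generalize orderKCoeff k lam (c + 2) = T₂ at *
  have hd : (0 : ℝ) < 2 ^ 40 - n := by linarith
  have key := mul_le_mul_of_nonneg_right a1 hd.le
  constructor
  · have b : (2 ^ 40 - (n : ℝ)) * T₀ ≤ g 2 := by nlinarith
    refine lt_of_mul_lt_mul_right ?_ (mul_nonneg hd.le (by norm_num : (0 : ℝ) ≤ 2 ^ 40))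
    linarith
  · have b : (2 ^ 40 - (n : ℝ)) * T₂ ≤ g 0 := by nlinarith
    refine lt_of_mul_lt_mul_right ?_ (mul_nonneg hd.le (by norm_num : (0 : ℝ) ≤ 2 ^ 40))
    linarith

theorem orderKCoeff_neighbors_lt_of_small {c : ℕ} (hk : 2 ≤ k) (hkn : k * (k + 1) ≤ n)
    (hn : lam * ((k : ℝ) * (k + 1)) = 2 * n) (hT : lam * ((k : ℝ) + 1 / 2) < 48)
    (hc : c + 1 + (3 * k + 5) / 8 = n) :
    orderKCoeff k lam c < orderKCoeff k lam (c + 1) ∧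
      orderKCoeff k lam (c + 2) < orderKCoeff k lam (c + 1) := by
  have hk' : (2 : ℝ) ≤ k := by exact_mod_cast hk
  have hkn' : (k : ℝ) * (k + 1) ≤ n := by exact_mod_cast hkn
  have hK0 : 0 < (k : ℝ) * (k + 1) := by positivity
  have hlam2 : 2 ≤ lam := by
    by_contra hcon
    nlinarith
  have hk24 : k < 24 := by
    have : (k : ℝ) < 24 := by nlinarith
    exact_mod_cast this
  have hlt : n * (2 * k + 1) < 48 * (k * (k + 1)) := by
    have : (n : ℝ) * (2 * k + 1) < 48 * (k * (k + 1)) := by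
      have := mul_lt_mul_of_pos_right hT hK0
      nlinarith
    exact_mod_cast this
  have hn564 : n < 564 := by
    by_contra hcon
    have h1 : 564 * (2 * k + 1) ≤ n * (2 * k + 1) := Nat.mul_le_mul_right _ (by omega)
    interval_cases k <;> omega
  have hrow := peakCheckRow_of_small hk hk24
  rw [peakCheckRow, List.all_eq_true] at hrow
  have h2 := hrow n (List.mem_range.mpr hn564)
  simp only [Bool.or_eq_true, Nat.ble_eq, Nat.blt_eq] at h2
  have h3 : peakCheck k n = true := by
    rcases h2 with (h2 | h2) | h2
    · omega
    · omega
    · exact h2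
  refine orderKCoeff_neighbors_lt_of_peakCheck hk hk24 hn (by linarith) ?_ (by omega) hc h3
  nlinarith

end FixedPointSpec

/-- For order one the coefficients satisfy the first-order recurrence of the Poisson weights. -/
theorem orderKCoeff_one_succ (lam : ℝ) (m : ℕ) :
    ((m : ℝ) + 1) * orderKCoeff 1 lam (m + 1) = lam * orderKCoeff 1 lam m := by
  have h := orderKCoeff_recurrence 1 lam (m + 1)
  simpa using h

theorem orderKCoeff_one_le {n : ℕ} (hn : 0 < n) (j : ℕ) :
    orderKCoeff 1 n j ≤ orderKCoeff 1 n (n - 1) := by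
  have hpos : (0 : ℝ) < n := by exact_mod_cast hn
  rcases le_total j (n - 1) with hj | hj
  · refine monotoneOn_of_le_succ (f := orderKCoeff 1 (n : ℝ)) (s := Set.Iic (n - 1)) Set.ordConnected_Iic
      (fun m _ _ hm => ?_) hj (Set.mem_Iic.mpr le_rfl) hj
    have hm' : (m : ℝ) + 1 ≤ n := by
      have : m + 1 ≤ n - 1 := hm
      exact_mod_cast (by omega : m + 1 ≤ n)
    have h := orderKCoeff_one_succ n m
    have hp := orderKCoeff_pos le_rfl hpos (m + 1)
    have hp' := orderKCoeff_pos le_rfl hpos m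
    rw [Nat.succ_eq_succ, Nat.succ_eq_add_one]
    nlinarith
  · refine antitoneOn_of_succ_le (f := orderKCoeff 1 (n : ℝ)) (s := Set.Ici (n - 1)) Set.ordConnected_Ici
      (fun m _ hm _ => ?_) (Set.mem_Ici.mpr le_rfl) hj hj
    have hm' : (n : ℝ) ≤ m + 1 := by
      have : n - 1 ≤ m := hm
      exact_mod_cast (by omega : n ≤ m + 1)
    have h := orderKCoeff_one_succ n m
    have hp := orderKCoeff_pos le_rfl hpos (m + 1)
    have hp' := orderKCoeff_pos le_rfl hpos m
    rw [Nat.succ_eq_succ, Nat.succ_eq_add_one]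
    nlinarith

theorem orderKCoeff_lt_peak {k n : ℕ} {lam : ℝ} (hk : 2 ≤ k) (hkn : k * (k + 1) ≤ n)
    (hn : lam * ((k : ℝ) * (k + 1)) = 2 * n) {j : ℕ} (hj : j ≠ n - (3 * k + 5) / 8) :
    orderKCoeff k lam j < orderKCoeff k lam (n - (3 * k + 5) / 8) := by
  have hk' : (2 : ℝ) ≤ k := by exact_mod_cast hk
  have hkn' : (k : ℝ) * (k + 1) ≤ n := by exact_mod_cast hkn
  have hK0 : 0 < (k : ℝ) * (k + 1) := by positivity
  have hlam : 2 ≤ lam := by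
    by_contra hcon
    nlinarith
  have hn3 : 3 * k ≤ n := le_trans (by nlinarith) hkn
  obtain ⟨c, hc⟩ : ∃ c, c + 1 + (3 * k + 5) / 8 = n := ⟨n - (3 * k + 5) / 8 - 1, by omega⟩
  have hpeak : n - (3 * k + 5) / 8 = c + 1 := by omega
  rw [hpeak] at hj ⊢
  obtain ⟨h1, h2⟩ : orderKCoeff k lam c < orderKCoeff k lam (c + 1) ∧
      orderKCoeff k lam (c + 2) < orderKCoeff k lam (c + 1) := by
    rcases le_or_gt 48 (lam * ((k : ℝ) + 1 / 2)) with hT | hT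
    · exact orderKCoeff_neighbors_lt_of_large hk hkn hn hT hc
    · exact orderKCoeff_neighbors_lt_of_small hk hkn hn hT hc
  exact lt_of_logConcave_of_lt_neighbors
    (fun m => orderKCoeff_pos (by omega) (by linarith) m)
    (fun m => orderKCoeff_logConcave (by omega) hlam m) h1 h2 hj

/-- Conjecture: For k ≥ 1 and an integer n ≥ 2κ, with λ = n/κ (so the
mean equals n), the Poisson distribution of order k has mode m_k(n/κ) = n − ⌊(3k+5)/8⌋,
and for k > 1 this mode is unique. -/
theorem poissonOrderK_mode_integer_mean (k n : ℕ) (hk : 1 ≤ k)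
    (hn : 2 * (k * (k + 1) / 2) ≤ n) (lam : ℝ)
    (hlam : lam = (n : ℝ) / ((k * (k + 1) / 2 : ℕ) : ℝ)) :
    (∀ j : ℕ, poissonOrderKPmf k lam j ≤ poissonOrderKPmf k lam (n - (3 * k + 5) / 8)) ∧
    (1 < k → ∀ j : ℕ, j ≠ n - (3 * k + 5) / 8 →
      poissonOrderKPmf k lam j < poissonOrderKPmf k lam (n - (3 * k + 5) / 8)) := by
  have hkk : 2 * (k * (k + 1) / 2) = k * (k + 1) :=
    Nat.two_mul_div_two_of_even (Nat.even_mul_succ_self k)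
  have hmean : lam * ((k : ℝ) * (k + 1)) = 2 * n := by
    have hcast : 2 * ((k * (k + 1) / 2 : ℕ) : ℝ) = k * (k + 1) := by exact_mod_cast hkk
    have hpos : (0 : ℝ) < (k * (k + 1) / 2 : ℕ) := by
      have : (1 : ℝ) ≤ k := by exact_mod_cast hk
      nlinarith
    rw [hlam, ← hcast]
    field_simp
  have hstrict : 1 < k → ∀ j : ℕ, j ≠ n - (3 * k + 5) / 8 →
      poissonOrderKPmf k lam j < poissonOrderKPmf k lam (n - (3 * k + 5) / 8) := by
    intro hk1 j hj
    simp only [poissonOrderKPmf_eq_exp_mul_orderKCoeff]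
    exact mul_lt_mul_of_pos_left (orderKCoeff_lt_peak hk1 (hkk ▸ hn) hmean hj) (Real.exp_pos _)
  refine ⟨fun j => ?_, hstrict⟩
  rcases hk.eq_or_lt with rfl | hk1
  · have hlam' : lam = n := by simpa using hlam
    simp only [poissonOrderKPmf_eq_exp_mul_orderKCoeff, hlam']
    exact mul_le_mul_of_nonneg_left (orderKCoeff_one_le (by omega) j) (Real.exp_nonneg _)
  · rcases eq_or_ne j (n - (3 * k + 5) / 8) with rfl | hj
    · exact le_rfl
    · exact (hstrict hk1 j hj).le
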